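/- Let A(Γ₀) be an Artin-Tits group of large type with generating set S, and let w be any word over S ∪ S⁻¹. Then there exists a geodesic word w' such that w̄ = w̄' and w →_{0,1,2⋆} w'. -/

import Mathlib

namespace ArtinTits

open Classical List

variable {S : Type*}

/-- A word over `S ∪ S⁻¹`: a list of letters, each a generator together with a sign
(`true` = the generator itself, `false` = its formal inverse). -/
abbrev Word (S : Type*) := List (S × Bool)

/-- The formal inverse of a word. -/
def wordInv (w : Word S) : Word S := w.reverse.map fun l => (l.1, !l.2)

/-- `[x,y,j⟩`: the alternating positive word `xyxy⋯` with `j` letters, beginning with `x`. -/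
def altWord (x y : S) : ℕ → Word S
  | 0 => []
  | j + 1 => (x, true) :: altWord y x j

/-- `⟨x,y,j]`: the alternating positive word `⋯xy` with `j` letters, ending with `y`. -/
def altWordR (x y : S) (j : ℕ) : Word S := (altWord y x j).reverse

/-- The data of a labelled finite complete simplicial graph `Γ₀`: a symmetric label map
with values in `{2,3,…} ∪ {∞}` on pairs of distinct vertices. -/
structure ArtinData (S : Type*) where
  m : S → S → ℕ∞
  symm : ∀ s t, m s t = m t s
  two_le : ∀ s t : S, s ≠ t → 2 ≤ m s t

/-- `u = v` is a defining (braid) relation of the Artin–Tits presentation. -/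
def IsRel (A : ArtinData S) (u v : Word S) : Prop :=
  ∃ (s t : S) (k : ℕ), s ≠ t ∧ A.m s t = (k : ℕ∞) ∧
    u = altWord s t k ∧ v = altWord t s k

/-- The relator set of the Artin–Tits presentation, inside the free group. -/
def rels (A : ArtinData S) : Set (FreeGroup S) :=
  {x | ∃ u v : Word S, IsRel A u v ∧ x = FreeGroup.mk u * (FreeGroup.mk v)⁻¹}

/-- The Artin–Tits group `A(Γ₀)` of the presentation. -/
abbrev ArtinGroup (A : ArtinData S) := PresentedGroup (rels A)

/-- `w̄`: the element of the Artin–Tits group represented by the word `w`. -/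
def wbar (A : ArtinData S) (w : Word S) : ArtinGroup A :=
  PresentedGroup.mk (rels A) (FreeGroup.mk w)

/-! ### Special transformations -/

/-- Type 0: delete a factor `s s⁻¹` or `s⁻¹ s`. -/
def Step0 (w w' : Word S) : Prop :=
  ∃ (w₁ w₂ : Word S) (s : S) (b : Bool),
    w = w₁ ++ [(s, b), (s, !b)] ++ w₂ ∧ w' = w₁ ++ w₂

/-- Type ∞: insert a factor `s s⁻¹` or `s⁻¹ s` (the inverse of type 0). -/
def StepInfty (w w' : Word S) : Prop := Step0 w' w

/-- Type 1: replace a factor `v` by `u`, or `v⁻¹` by `u⁻¹`, where `u = v` is a defining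
relation. -/
def Step1 (A : ArtinData S) (w w' : Word S) : Prop :=
  ∃ (w₁ w₂ u v : Word S), IsRel A u v ∧
    ((w = w₁ ++ v ++ w₂ ∧ w' = w₁ ++ u ++ w₂) ∨
     (w = w₁ ++ wordInv v ++ w₂ ∧ w' = w₁ ++ wordInv u ++ w₂))

/-- Type 2r: for a defining relation `u₁u₂ = v₁v₂` with `u₁, v₁` non-empty, replace a factor
`v₁⁻¹ u₁` by `v₂ u₂⁻¹`. -/
def Step2r (A : ArtinData S) (w w' : Word S) : Prop :=
  ∃ (w₁ w₂ u₁ u₂ v₁ v₂ : Word S), IsRel A (u₁ ++ u₂) (v₁ ++ v₂) ∧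
    u₁ ≠ [] ∧ v₁ ≠ [] ∧
    w = w₁ ++ wordInv v₁ ++ u₁ ++ w₂ ∧ w' = w₁ ++ v₂ ++ wordInv u₂ ++ w₂

/-- Type 2l: for a defining relation `u₁u₂ = v₁v₂` with `u₂, v₂` non-empty, replace a factor
`v₂ u₂⁻¹` by `v₁⁻¹ u₁`. -/
def Step2l (A : ArtinData S) (w w' : Word S) : Prop :=
  ∃ (w₁ w₂ u₁ u₂ v₁ v₂ : Word S), IsRel A (u₁ ++ u₂) (v₁ ++ v₂) ∧
    u₂ ≠ [] ∧ v₂ ≠ [] ∧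
    w = w₁ ++ v₂ ++ wordInv u₂ ++ w₂ ∧ w' = w₁ ++ wordInv v₁ ++ u₁ ++ w₂

/-- Type 2: a type 2r or type 2l transformation. -/
def Step2 (A : ArtinData S) (w w' : Word S) : Prop := Step2r A w w' ∨ Step2l A w w'

/-- `p` is the greatest (longest) common left factor of `x` and `y`. -/
def IsLCPrefix (p x y : Word S) : Prop :=
  p <+: x ∧ p <+: y ∧ ∀ q : Word S, q <+: x → q <+: y → q.length ≤ p.length

/-- `p` is the greatest (longest) common right factor of `x` and `y`. -/
def IsLCSuffix (p x y : Word S) : Prop :=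
  p <:+ x ∧ p <:+ y ∧ ∀ q : Word S, q <:+ x → q <:+ y → q.length ≤ p.length

/-- Type 2r⋆ : a type 2r transformation `w₁ v⁻¹ v' w₂ → w₁ u (u')⁻¹ w₂` (with `vu = v'u'` a
defining relation) such that `v` is the greatest common left factor of `vu` and `v w₁⁻¹`, and
`v'` is the greatest common left factor of `v'u'` and `v' w₂`. -/
def Step2rStar (A : ArtinData S) (w w' : Word S) : Prop :=
  ∃ (w₁ w₂ v u v' u' : Word S), IsRel A (v ++ u) (v' ++ u') ∧
    v ≠ [] ∧ v' ≠ [] ∧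
    w = w₁ ++ wordInv v ++ v' ++ w₂ ∧
    w' = w₁ ++ u ++ wordInv u' ++ w₂ ∧
    IsLCPrefix v (v ++ u) (v ++ wordInv w₁) ∧
    IsLCPrefix v' (v' ++ u') (v' ++ w₂)

/-- Type 2l⋆ : a type 2l transformation `w₁ v (v')⁻¹ w₂ → w₁ u⁻¹ u' w₂` (with `uv = u'v'` a
defining relation) such that `v` is the greatest common right factor of `uv` and `w₁ v`, and
`v'` is the greatest common right factor of `u'v'` and `w₂⁻¹ v'`. -/
def Step2lStar (A : ArtinData S) (w w' : Word S) : Prop :=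
  ∃ (w₁ w₂ v u v' u' : Word S), IsRel A (u ++ v) (u' ++ v') ∧
    v ≠ [] ∧ v' ≠ [] ∧
    w = w₁ ++ v ++ wordInv v' ++ w₂ ∧
    w' = w₁ ++ wordInv u ++ u' ++ w₂ ∧
    IsLCSuffix v (u ++ v) (w₁ ++ v) ∧
    IsLCSuffix v' (u' ++ v') (wordInv w₂ ++ v')

/-- Type 2⋆ : a type 2r⋆ or type 2l⋆ transformation. -/
def Step2Star (A : ArtinData S) (w w' : Word S) : Prop :=
  Step2rStar A w w' ∨ Step2lStar A w w'

/-- `w →_{0,1,2} w'`. -/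
def Steps012 (A : ArtinData S) : Word S → Word S → Prop :=
  Relation.ReflTransGen fun x y => Step0 x y ∨ Step1 A x y ∨ Step2 A x y

/-- `w →_{0,1,2⋆} w'`. -/
def Steps012Star (A : ArtinData S) : Word S → Word S → Prop :=
  Relation.ReflTransGen fun x y => Step0 x y ∨ Step1 A x y ∨ Step2Star A x y

/-- `w →_{2⋆} w'`. -/
def Steps2Star (A : ArtinData S) : Word S → Word S → Prop :=
  Relation.ReflTransGen (Step2Star A)

/-- `w →_{1,2⋆} w'`. -/
def Steps12Star (A : ArtinData S) : Word S → Word S → Prop :=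
  Relation.ReflTransGen fun x y => Step1 A x y ∨ Step2Star A x y

/-- `w →_{1,2} w'`. -/
def Steps12 (A : ArtinData S) : Word S → Word S → Prop :=
  Relation.ReflTransGen fun x y => Step1 A x y ∨ Step2 A x y

/-! ### Classes of words -/

/-- A positive word: written over `S`. -/
def Positive (w : Word S) : Prop := ∀ l ∈ w, l.2 = true

/-- A negative word: written over `S⁻¹`. -/
def Negative (w : Word S) : Prop := ∀ l ∈ w, l.2 = false

/-- A signed word: positive or negative. -/
def Signed (w : Word S) : Prop := Positive w ∨ Negative w

/-- An unsigned word: neither positive nor negative. -/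
def Unsigned (w : Word S) : Prop := ¬ Positive w ∧ ¬ Negative w

/-- A freely reduced word: no factor `s s⁻¹` or `s⁻¹ s`. -/
def FreelyReduced (w : Word S) : Prop :=
  ∀ (w₁ w₂ : Word S) (s : S) (b : Bool), w ≠ w₁ ++ [(s, b), (s, !b)] ++ w₂

/-- A square-free word: no factor `aa`. -/
def SquareFree (w : Word S) : Prop := ∀ a : S × Bool, ¬ [a, a] <:+: w

/-- `p̃(w)`: the length of the longest square-free positive factor of `w`. -/
noncomputable def ptilde (w : Word S) : ℕ :=
  sSup {n | ∃ v : Word S, v <:+: w ∧ Positive v ∧ SquareFree v ∧ v.length = n}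

/-- `ñ(w)`: the length of the longest negative factor of `w` whose formal inverse is
square-free. -/
noncomputable def ntilde (w : Word S) : ℕ :=
  sSup {n | ∃ v : Word S, v <:+: w ∧ Negative v ∧ SquareFree (wordInv v) ∧ v.length = n}

/-- `p(w) = min(p̃(w), m)`. -/
noncomputable def pfun (M : ℕ) (w : Word S) : ℕ := min (ptilde w) M

/-- `n(w) = min(ñ(w), m)`. -/
noncomputable def nfun (M : ℕ) (w : Word S) : ℕ := min (ntilde w) M

/-- `Ω(Γ₀)` (for a dihedral presentation with label `M`): the freely reduced words with
`max(p(w), n(w)) < M`. -/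
def Omega (M : ℕ) (w : Word S) : Prop :=
  FreelyReduced w ∧ max (pfun M w) (nfun M w) < M

/-- A signed square-free word (square-free positive, or negative with square-free inverse). -/
def SignedSF (w : Word S) : Prop :=
  (Positive w ∧ SquareFree w) ∨ (Negative w ∧ SquareFree (wordInv w))

/-- `v` is the maximal square-free signed left factor of `w`. -/
def MaxSignedSFPrefix (v w : Word S) : Prop :=
  v <+: w ∧ SignedSF v ∧ ∀ v' : Word S, v' <+: w → SignedSF v' → v'.length ≤ v.length

/-- `(v₁, …, v_k)` is the `⋆`-decomposition of `w`: the `v_i` are non-empty, `w = v₁⋯v_k`,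
and each `v_i` is the maximal square-free signed left factor of `v_i⋯v_k`. -/
def StarDecomp (w : Word S) (L : List (Word S)) : Prop :=
  w = L.flatten ∧ (∀ v ∈ L, v ≠ ([] : Word S)) ∧
    ∀ i (h : i < L.length), MaxSignedSFPrefix (L.get ⟨i, h⟩) ((L.drop i).flatten)

/-! ### Groups, parabolic subgroups, geodesics -/

/-- A word written over `T ∪ T⁻¹` for a subset `T` of the generators. -/
def WordOver (T : Set S) (w : Word S) : Prop := ∀ l ∈ w, l.1 ∈ T

/-- The standard parabolic subgroup `A_T` generated by the image of `T ⊆ S`. -/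
def parab (A : ArtinData S) (T : Set S) : Subgroup (ArtinGroup A) :=
  Subgroup.closure {x | ∃ s ∈ T, x = wbar A [(s, true)]}

/-- A geodesic word: of minimal length among all words representing the same element. -/
def Geodesic (A : ArtinData S) (w : Word S) : Prop :=
  ∀ w' : Word S, wbar A w' = wbar A w → w.length ≤ w'.length

/-- A word over `T ∪ T⁻¹` that is geodesic among the words over `T ∪ T⁻¹` representing the
same element. -/
def GeodesicOver (A : ArtinData S) (T : Set S) (w : Word S) : Prop :=
  WordOver T w ∧
    ∀ w' : Word S, WordOver T w' → wbar A w' = wbar A w → w.length ≤ w'.length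

/-- The length of a group element: the length of any geodesic representative word. -/
noncomputable def elLength (A : ArtinData S) (g : ArtinGroup A) : ℕ :=
  sInf {n | ∃ w : Word S, wbar A w = g ∧ w.length = n}

/-- A positive element: one represented by a positive word. -/
def IsPosElt (A : ArtinData S) (g : ArtinGroup A) : Prop :=
  ∃ w : Word S, Positive w ∧ wbar A w = g

/-- An `H`-transversal: a subset containing `1` and exactly one element of each left
`H`-coset. -/
def IsLeftTransversal {G : Type*} [Group G] (H : Subgroup G) (T : Set G) : Prop :=
  (1 : G) ∈ T ∧ ∀ g : G, ∃! x, x ∈ T ∧ g⁻¹ * x ∈ H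

/-! ### Properties H, H⁺, H# -/

/-- Property `H`: `w →_{0,1,2} ε ↔ w̄ = 1`. -/
def PropertyH (A : ArtinData S) : Prop :=
  ∀ w : Word S, Steps012 A w [] ↔ wbar A w = 1

/-- Property `H⁺`: every word representing an element of a standard parabolic subgroup
`A_{S₀}` can be transformed by `→_{0,1,2⋆}` into a word over `S₀ ∪ S₀⁻¹`. -/
def PropertyHPlus (A : ArtinData S) : Prop :=
  ∀ (S₀ : Set S) (w : Word S), wbar A w ∈ parab A S₀ →
    ∃ w₀ : Word S, WordOver S₀ w₀ ∧ Steps012Star A w w₀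

/-- Property `H#` with respect to an `S`-sequence of transversals `T`. -/
def PropertyHSharpWrt (A : ArtinData S) (T : Set S → Set (ArtinGroup A)) : Prop :=
  (∀ S₀ : Set S, IsLeftTransversal (parab A S₀) (T S₀)) ∧
    ∀ (S' S₀ : Set S) (w : Word S), wbar A w ∈ parab A S' →
      ∃ v u : Word S, WordOver S' v ∧ WordOver (S' ∩ S₀) u ∧
        Steps012 A w (v ++ u) ∧ wbar A v ∈ T S₀

/-- Property `H#`: property `H#` with respect to some `S`-sequence of transversals. -/
def PropertyHSharp (A : ArtinData S) : Prop :=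
  ∃ T : Set S → Set (ArtinGroup A), PropertyHSharpWrt A T

/-! ### Critical words and the involution τ (relative to a dihedral pair) -/

/-- The permutation `δ` induced by conjugation by `Δ`, extended letterwise to words:
the identity if `M` is even, and the swap of `s` and `t` if `M` is odd. -/
noncomputable def deltaMap (s t : S) (M : ℕ) (w : Word S) : Word S :=
  if Even M then w
  else w.map fun l => (if l.1 = s then t else if l.1 = t then s else l.1, l.2)

/-- `w` is an unsigned critical word (of the dihedral pair `{s,t}` with label `M`) and
`w' = τ(w)`. -/
def UCritTauPair (A : ArtinData S) (s t : S) (M : ℕ) (w w' : Word S) : Prop :=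
  WordOver {s, t} w ∧ FreelyReduced w ∧ Unsigned w ∧ GeodesicOver A {s, t} w ∧
  pfun M w + nfun M w = M ∧
  ∃ (x y z z' : S) (wm : Word S),
    ({x, y} : Set S) = {s, t} ∧ ({z, z'} : Set S) = {s, t} ∧
    ((w = altWord x y (pfun M w) ++ wm ++ wordInv (altWord z z' (nfun M w)) ∧
      w' = wordInv (altWordR x y (nfun M w)) ++ deltaMap s t M wm ++
        altWordR z z' (pfun M w)) ∨
     (w = wordInv (altWordR x y (nfun M w)) ++ wm ++ altWordR z z' (pfun M w) ∧
      w' = altWord x y (pfun M w) ++ deltaMap s t M wm ++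
        wordInv (altWord z z' (nfun M w))))

/-- `w` is a positive critical word (of the dihedral pair `{s,t}` with label `M`) and
`w' = τ(w)`. -/
def PosCritTauPair (A : ArtinData S) (s t : S) (M : ℕ) (w w' : Word S) : Prop :=
  WordOver {s, t} w ∧ Positive w ∧ pfun M w = M ∧
  ∃ (x y : S) (wm : Word S), ({x, y} : Set S) = {s, t} ∧ pfun M wm < M ∧
    ((w = altWord x y M ++ wm ∧
      (w' = deltaMap s t M wm ++ altWordR x y M ∨
       w' = deltaMap s t M wm ++ altWordR y x M) ∧
      w'.getLast? ≠ w.getLast?) ∨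
     (w = wm ++ altWordR x y M ∧
      (w' = altWord x y M ++ deltaMap s t M wm ∨
       w' = altWord y x M ++ deltaMap s t M wm) ∧
      w'.head? ≠ w.head?))

/-- `w` is a negative critical word and `w' = τ(w)` (defined via formal inverses). -/
def NegCritTauPair (A : ArtinData S) (s t : S) (M : ℕ) (w w' : Word S) : Prop :=
  PosCritTauPair A s t M (wordInv w) (wordInv w')

/-- `w` is a critical word (unsigned, positive or negative) and `w' = τ(w)`. -/
def CritTauPair (A : ArtinData S) (s t : S) (M : ℕ) (w w' : Word S) : Prop :=
  UCritTauPair A s t M w w' ∨ PosCritTauPair A s t M w w' ∨ NegCritTauPair A s t M w w'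

/-- A type β transformation relative to the dihedral pair `{s,t}` with label `M`:
replace a critical factor `v` by `τ(v)`. -/
def StepBetaPair (A : ArtinData S) (s t : S) (M : ℕ) (w w' : Word S) : Prop :=
  ∃ (w₁ w₂ v v' : Word S), w = w₁ ++ v ++ w₂ ∧ w' = w₁ ++ v' ++ w₂ ∧
    CritTauPair A s t M v v'

/-- A type β transformation (in an Artin–Tits group): a type β transformation relative to some
dihedral standard parabolic subgroup (a pair of generators with finite label). -/
def StepBeta (A : ArtinData S) (w w' : Word S) : Prop :=
  ∃ (s t : S) (M : ℕ), s ≠ t ∧ A.m s t = (M : ℕ∞) ∧ StepBetaPair A s t M w w'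

/-! ### Restriction, direct products, Coxeter graph notions -/

/-- The Artin–Tits presentation induced on a subset `T` of the generators (the presentation of
the standard parabolic subgroup `A_T`). -/
def ArtinData.restrict (A : ArtinData S) (T : Set S) : ArtinData T where
  m a b := A.m a b
  symm a b := A.symm a b
  two_le a b h := A.two_le a b fun h' => h (Subtype.ext h')

/-- The Artin–Tits presentation on the disjoint union `S₁ ⊕ S₂` obtained from presentations on
`S₁` and `S₂` by adding the commuting relations `s₁s₂ = s₂s₁` (label `2`) for `s₁ ∈ S₁`,
`s₂ ∈ S₂`. -/
def prodData {S₁ S₂ : Type*} (A₁ : ArtinData S₁) (A₂ : ArtinData S₂) :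
    ArtinData (S₁ ⊕ S₂) where
  m x y :=
    match x, y with
    | Sum.inl a, Sum.inl b => A₁.m a b
    | Sum.inr a, Sum.inr b => A₂.m a b
    | _, _ => 2
  symm x y := by
    cases x <;> cases y
    · exact A₁.symm _ _
    · rfl
    · rfl
    · exact A₂.symm _ _
  two_le x y h := by
    cases x <;> cases y
    · exact A₁.two_le _ _ fun h' => h (congrArg Sum.inl h')
    · exact le_rfl
    · exact le_rfl
    · exact A₂.two_le _ _ fun h' => h (congrArg Sum.inr h')

/-- Adjacency in the Coxeter graph `Γ` restricted to `T`: distinct vertices of `T` joined by an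
edge (i.e. with label `≠ 2`, edges labelled `2` being removed in `Γ`). -/
def coxAdj (A : ArtinData S) (T : Set S) (x y : S) : Prop :=
  x ∈ T ∧ y ∈ T ∧ x ≠ y ∧ A.m x y ≠ 2

/-- The full subgraph of the Coxeter graph on the vertex subset `T` is connected. -/
def CoxConnected (A : ArtinData S) (T : Set S) : Prop :=
  ∀ x ∈ T, ∀ y ∈ T, Relation.ReflTransGen (coxAdj A T) x y

/-- The relator set of the Coxeter presentation on `T`: the Artin relations together with the
squares of the generators. -/
def coxRels (A : ArtinData S) (T : Set S) : Set (FreeGroup T) :=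
  rels (A.restrict T) ∪ {g | ∃ x : T, g = FreeGroup.of x * FreeGroup.of x}

/-- The induced presentation on `T` is of spherical type: its Coxeter group is finite. -/
def SphericalType (A : ArtinData S) (T : Set S) : Prop :=
  Finite (PresentedGroup (coxRels A T))

/-- The induced presentation on `T` is of large type: all labels are `≥ 3` (possibly `∞`). -/
def LargeTypeOn (A : ArtinData S) (T : Set S) : Prop :=
  ∀ x ∈ T, ∀ y ∈ T, x ≠ y → 3 ≤ A.m x y

/-! ### Words and the elements they represent -/

lemma wordInv_append (x y : Word S) : wordInv (x ++ y) = wordInv y ++ wordInv x := by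
  simp [wordInv]

/-- The formal inverse of a letter. -/
def letterInv (a : S × Bool) : S × Bool := (a.1, !a.2)

@[simp] lemma letterInv_letterInv (a : S × Bool) : letterInv (letterInv a) = a := by
  simp [letterInv]

@[simp] lemma letterInv_fst (a : S × Bool) : (letterInv a).1 = a.1 := rfl

lemma eq_or_eq_letterInv {a b : S × Bool} (h : a.1 = b.1) : b = a ∨ b = letterInv a := by
  obtain ⟨x, i⟩ := a
  obtain ⟨y, j⟩ := b
  obtain rfl : x = y := h
  cases i <;> cases j <;> simp [letterInv]

section wbar
variable (A : ArtinData S)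

lemma wbar_append (x y : Word S) : wbar A (x ++ y) = wbar A x * wbar A y := by
  rw [wbar, ← FreeGroup.mul_mk, map_mul]; rfl

lemma wbar_cons (a : S × Bool) (y : Word S) : wbar A (a :: y) = wbar A [a] * wbar A y :=
  wbar_append A [a] y

lemma wbar_wordInv (x : Word S) : wbar A (wordInv x) = (wbar A x)⁻¹ := by
  rw [wbar, wbar, ← map_inv, FreeGroup.inv_mk]
  simp [wordInv, FreeGroup.invRev]

lemma wbar_letterInv (a : S × Bool) : wbar A [letterInv a] = (wbar A [a])⁻¹ :=
  wbar_wordInv A [a]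

variable {A}

lemma wbar_eq_of_isRel {u v : Word S} (h : IsRel A u v) : wbar A u = wbar A v := by
  have := PresentedGroup.one_of_mem (show FreeGroup.mk u * (FreeGroup.mk v)⁻¹ ∈ rels A from
    ⟨u, v, h, rfl⟩)
  rw [map_mul, map_inv] at this
  exact mul_inv_eq_one.1 this

lemma wbar_cons_cons_cancel (a : S × Bool) (x : Word S) :
    wbar A (a :: letterInv a :: x) = wbar A x := by
  rw [wbar_cons, wbar_cons A (letterInv a), wbar_letterInv]; group

/-- The value of a word under an assignment of group elements to the generators. -/
def evalWord {H : Type*} [Group H] (f : S → H) (w : Word S) : H :=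
  (w.map fun l => bif l.2 then f l.1 else (f l.1)⁻¹).prod

@[simp] lemma evalWord_nil {H : Type*} [Group H] (f : S → H) : evalWord f [] = 1 := rfl

lemma evalWord_cons {H : Type*} [Group H] (f : S → H) (l : S × Bool) (w : Word S) :
    evalWord f (l :: w) = (bif l.2 then f l.1 else (f l.1)⁻¹) * evalWord f w := by
  simp [evalWord]

/-- A map of the generators to a group that respects the braid relations extends to the
Artin–Tits group. -/
lemma exists_hom {H : Type*} [Group H] (f : S → H)
    (hf : ∀ s t (k : ℕ), s ≠ t → A.m s t = k →
      evalWord f (altWord s t k) = evalWord f (altWord t s k)) :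
    ∃ φ : ArtinGroup A →* H, ∀ w, φ (wbar A w) = evalWord f w := by
  have h : ∀ r ∈ rels A, FreeGroup.lift f r = 1 := by
    rintro r ⟨u, v, ⟨s, t, k, hst, hk, rfl, rfl⟩, rfl⟩
    rw [map_mul, map_inv, FreeGroup.lift_mk, FreeGroup.lift_mk, mul_inv_eq_one]
    exact hf s t k hst hk
  refine ⟨PresentedGroup.toGroup h, fun w => ?_⟩
  exact FreeGroup.lift_mk

end wbar

/-! ### Elementary properties of the transformations -/

section steps
variable {A : ArtinData S}

lemma IsRel.symm {u v : Word S} (h : IsRel A u v) : IsRel A v u := by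
  obtain ⟨s, t, k, hst, hk, rfl, rfl⟩ := h
  exact ⟨t, s, k, hst.symm, by rw [A.symm, hk], rfl, rfl⟩

lemma wbar_step0 {x y : Word S} (h : Step0 x y) : wbar A x = wbar A y := by
  obtain ⟨w₁, w₂, s, b, rfl, rfl⟩ := h
  have : wbar A [(s, b), (s, !b)] = 1 := wbar_cons_cons_cancel (s, b) []
  simp only [wbar_append, this]; group

lemma wbar_step1 {x y : Word S} (h : Step1 A x y) : wbar A x = wbar A y := by
  obtain ⟨w₁, w₂, u, v, hr, ⟨rfl, rfl⟩ | ⟨rfl, rfl⟩⟩ := h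
  · simp only [wbar_append, wbar_eq_of_isRel hr]
  · simp only [wbar_append, wbar_wordInv, wbar_eq_of_isRel hr]

lemma wbar_step2Star {x y : Word S} (h : Step2Star A x y) : wbar A x = wbar A y := by
  rcases h with ⟨w₁, w₂, v, u, v', u', hr, -, -, rfl, rfl, -⟩ |
    ⟨w₁, w₂, v, u, v', u', hr, -, -, rfl, rfl, -⟩
  · have := wbar_eq_of_isRel hr
    simp only [wbar_append] at this
    have h2 : (wbar A v)⁻¹ * wbar A v' = wbar A u * (wbar A u')⁻¹ := by
      rw [inv_mul_eq_iff_eq_mul, ← mul_assoc, this]; group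
    simp only [wbar_append, wbar_wordInv, mul_assoc (wbar A w₁), h2]
  · have := wbar_eq_of_isRel hr
    simp only [wbar_append] at this
    have h2 : (wbar A u)⁻¹ * wbar A u' = wbar A v * (wbar A v')⁻¹ := by
      rw [inv_mul_eq_iff_eq_mul, ← mul_assoc, this]; group
    simp only [wbar_append, wbar_wordInv, mul_assoc (wbar A w₁), h2]

lemma wbar_steps {x y : Word S} (h : Steps012Star A x y) : wbar A x = wbar A y := by
  induction h with
  | refl => rfl
  | tail _ h ih =>
    rw [ih]
    rcases h with h | h | h
    exacts [wbar_step0 h, wbar_step1 h, wbar_step2Star h]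

lemma isLCPrefix_iff {v u z : Word S} :
    IsLCPrefix v (v ++ u) (v ++ z) ↔ ∀ c, u.head? = some c → z.head? ≠ some c := by
  constructor
  · rintro ⟨-, -, h⟩ c hu hz
    obtain ⟨u', rfl⟩ : ∃ u', u = c :: u' := by cases u <;> simp_all
    obtain ⟨z', rfl⟩ : ∃ z', z = c :: z' := by cases z <;> simp_all
    have := h (v ++ [c]) ⟨u', by simp⟩ ⟨z', by simp⟩
    simp at this
  · intro h
    refine ⟨prefix_append _ _, prefix_append _ _, fun q hq hq' => ?_⟩
    by_contra! hlt
    obtain ⟨q', rfl⟩ := prefix_of_prefix_length_le (prefix_append v u) hq hlt.le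
    rw [prefix_append_right_inj] at hq hq'
    cases q' with
    | nil => simp at hlt
    | cons c q' =>
      obtain ⟨u', rfl⟩ := hq
      obtain ⟨z', rfl⟩ := hq'
      exact h c (by simp) (by simp)

lemma reverse_isPrefix_iff {u v : Word S} : u.reverse <+: v.reverse ↔ u <:+ v :=
  ⟨fun ⟨z, h⟩ => ⟨z.reverse, by simpa using congrArg reverse h⟩,
    fun ⟨z, h⟩ => ⟨z.reverse, by simp [← h]⟩⟩

lemma isLCSuffix_iff {v u z : Word S} :
    IsLCSuffix v (u ++ v) (z ++ v) ↔ ∀ c, u.getLast? = some c → z.getLast? ≠ some c := by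
  have key : IsLCSuffix v (u ++ v) (z ++ v) ↔
      IsLCPrefix v.reverse (v.reverse ++ u.reverse) (v.reverse ++ z.reverse) := by
    simp only [IsLCSuffix, IsLCPrefix, ← reverse_append, reverse_isPrefix_iff]
    refine and_congr_right fun _ => and_congr_right fun _ => ⟨fun h q hq hq' => ?_,
      fun h q hq hq' => ?_⟩
    · have := h q.reverse (by rw [← reverse_isPrefix_iff]; simpa using hq)
        (by rw [← reverse_isPrefix_iff]; simpa using hq')
      simpa using this
    · have := h q.reverse (reverse_isPrefix_iff.2 hq) (reverse_isPrefix_iff.2 hq')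
      simpa using this
  rw [key, isLCPrefix_iff]
  simp

/-- Length-reducing reachability fails: no strictly shorter word can be reached. -/
def Stuck (A : ArtinData S) (w : Word S) : Prop :=
  ∀ w', Steps012Star A w w' → w.length ≤ w'.length

lemma exists_stuck (A : ArtinData S) (w : Word S) : ∃ w', Steps012Star A w w' ∧ Stuck A w' := by
  obtain ⟨w', hw, hmin⟩ := exists_minimalFor_of_wellFoundedLT
    (fun x => Steps012Star A w x) List.length ⟨w, .refl⟩
  refine ⟨w', hw, fun x hx => ?_⟩
  by_contra! hlt
  exact absurd (hmin (hw.trans hx) hlt.le) (by simpa using hlt)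

lemma Stuck.of_steps {w w' : Word S} (h : Stuck A w) (hs : Steps012Star A w w')
    (hl : w'.length = w.length) : Stuck A w' :=
  fun x hx => hl ▸ h x (hs.trans hx)

lemma Stuck.of_geodesic {w : Word S} (h : Geodesic A w) : Stuck A w :=
  fun _ hx => h _ (wbar_steps hx).symm

lemma Stuck.not_cancel {w₁ w₂ : Word S} {a : S × Bool}
    (h : Stuck A (w₁ ++ a :: letterInv a :: w₂)) :
    False := by
  have := h (w₁ ++ w₂) (.single (.inl ⟨w₁, w₂, a.1, a.2, by simp [letterInv], rfl⟩))
  simp at this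

end steps

/-! ### Dihedral presentations and their embeddings -/

/-- The dihedral presentation with label `M`, on the generators `true`, `false`. -/
def dih (M : ℕ) (hM : 3 ≤ M) : ArtinData Bool where
  m _ _ := M
  symm _ _ := rfl
  two_le _ _ _ := by exact_mod_cast (show 2 ≤ M by lia)

/-- The letter of `S ∪ S⁻¹` obtained from a dihedral letter via `true ↦ s`, `false ↦ t`. -/
def embLetter (s t : S) (l : Bool × Bool) : S × Bool := (cond l.1 s t, l.2)

/-- The word over `{s,t}` obtained from a dihedral word via `true ↦ s`, `false ↦ t`. -/
def emb (s t : S) (w : Word Bool) : Word S := w.map (embLetter s t)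

section emb
variable (s t : S)

@[simp] lemma emb_nil : emb s t [] = [] := rfl

@[simp] lemma emb_cons (a : Bool × Bool) (x : Word Bool) :
    emb s t (a :: x) = embLetter s t a :: emb s t x := rfl

lemma emb_append (x y : Word Bool) : emb s t (x ++ y) = emb s t x ++ emb s t y :=
  map_append

@[simp] lemma emb_length (x : Word Bool) : (emb s t x).length = x.length := length_map ..

lemma emb_wordInv (x : Word Bool) : emb s t (wordInv x) = wordInv (emb s t x) := by
  simp [emb, wordInv, embLetter, Function.comp_def]

lemma emb_letterInv (a : Bool × Bool) :
    embLetter s t (letterInv a) = letterInv (embLetter s t a) := rfl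

lemma emb_altWord (a b : Bool) (k : ℕ) :
    emb s t (altWord a b k) = altWord (cond a s t) (cond b s t) k := by
  induction k generalizing a b with
  | zero => rfl
  | succ k ih => simp [altWord, ih, embLetter]

variable {s t}

lemma embLetter_injective (hst : s ≠ t) : Function.Injective (embLetter s t) := by
  rintro ⟨a, i⟩ ⟨b, j⟩ h
  simp only [embLetter, Prod.mk.injEq] at h
  cases a <;> cases b <;> simp_all [hst.symm]

lemma emb_injective (hst : s ≠ t) : Function.Injective (emb s t) :=
  map_injective_iff.2 (embLetter_injective hst)

lemma embLetter_fst (a : Bool × Bool) : (embLetter s t a).1 = s ∨ (embLetter s t a).1 = t := by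
  obtain ⟨a, i⟩ := a
  cases a <;> simp [embLetter]

lemma exists_embLetter {a : S × Bool} (h : a.1 = s ∨ a.1 = t) : ∃ b, embLetter s t b = a := by
  obtain ⟨a, i⟩ := a
  rcases h with rfl | rfl
  exacts [⟨(true, i), rfl⟩, ⟨(false, i), rfl⟩]

variable {A : ArtinData S} {M : ℕ} {hM : 3 ≤ M}

lemma IsRel.emb (hst : s ≠ t) (hm : A.m s t = M) {u v : Word Bool} (h : IsRel (dih M hM) u v) :
    IsRel A (emb s t u) (emb s t v) := by
  obtain ⟨a, b, k, hab, hk, rfl, rfl⟩ := h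
  have hk' : (M : ℕ∞) = k := hk
  obtain rfl : M = k := by exact_mod_cast hk'
  rw [emb_altWord, emb_altWord]
  cases a <;> cases b <;> simp at hab ⊢
  · exact ⟨t, s, M, hst.symm, by rw [A.symm, hm], rfl, rfl⟩
  · exact ⟨s, t, M, hst, hm, rfl, rfl⟩

/-- A word that may stand before an `{s,t}`-word without being extended by it: its last letter
is not over `{s,t}`. -/
def EndsOff (s t : S) (w : Word S) : Prop := ∀ c, w.getLast? = some c → c.1 ≠ s ∧ c.1 ≠ t

/-- The first letter of the word is not over `{s,t}`. -/
def StartsOff (s t : S) (w : Word S) : Prop := ∀ c, w.head? = some c → c.1 ≠ s ∧ c.1 ≠ t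

lemma EndsOff.wordInv {w : Word S} (h : EndsOff s t w) : StartsOff s t (wordInv w) := by
  intro c hc
  have : w.getLast? = some (letterInv c) := by
    simp only [ArtinTits.wordInv, head?_map, head?_reverse, Option.map_eq_some_iff] at hc
    obtain ⟨a, ha, rfl⟩ := hc
    simpa [letterInv] using ha
  simpa using h _ this

lemma StartsOff.wordInv {w : Word S} (h : StartsOff s t w) : EndsOff s t (wordInv w) := by
  intro c hc
  have : w.head? = some (letterInv c) := by
    simp only [ArtinTits.wordInv, getLast?_map, getLast?_reverse, Option.map_eq_some_iff] at hc
    obtain ⟨a, ha, rfl⟩ := hc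
    simpa [letterInv] using ha
  simpa using h _ this

lemma no_common_head_emb (hst : s ≠ t) {u z : Word Bool} {r : Word S} (hr : StartsOff s t r)
    (h : ∀ c, u.head? = some c → z.head? ≠ some c) (c : S × Bool)
    (hc : (emb s t u).head? = some c) : (emb s t z ++ r).head? ≠ some c := by
  intro hc'
  cases u with
  | nil => simp at hc
  | cons a u =>
    obtain rfl : embLetter s t a = c := by simpa using hc
    cases z with
    | nil =>
      have := hr _ (by simpa using hc')
      rcases embLetter_fst (s := s) (t := t) a with h | h <;> simp_all
    | cons b z =>
      have := embLetter_injective hst (by simpa using hc')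
      exact h a (by simp) (by simp [this])

lemma no_common_last_emb (hst : s ≠ t) {u z : Word Bool} {r : Word S} (hr : EndsOff s t r)
    (h : ∀ c, u.getLast? = some c → z.getLast? ≠ some c) (c : S × Bool)
    (hc : (emb s t u).getLast? = some c) : (r ++ emb s t z).getLast? ≠ some c := by
  have hr' : StartsOff s t r.reverse := fun c hc => hr c (by simpa using hc)
  have hrev (x : Word Bool) : emb s t x.reverse = (emb s t x).reverse := map_reverse
  have := no_common_head_emb hst (u := u.reverse) (z := z.reverse) hr' (by simpa using h) c
    (by simpa [hrev] using hc)
  simpa only [hrev, ← reverse_append, head?_reverse] using this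

lemma steps_emb (hst : s ≠ t) (hm : A.m s t = M) {w₁ w₂ : Word S} (h₁ : EndsOff s t w₁)
    (h₂ : StartsOff s t w₂) {x y : Word Bool} (h : Steps012Star (dih M hM) x y) :
    Steps012Star A (w₁ ++ emb s t x ++ w₂) (w₁ ++ emb s t y ++ w₂) := by
  induction h with
  | refl => exact .refl
  | @tail b c _ h ih =>
    refine ih.tail ?_
    rcases h with ⟨p, q, a, i, rfl, rfl⟩ | ⟨p, q, u, v, hr, h⟩ |
      ⟨p, q, v, u, v', u', hr, hv, hv', rfl, rfl, hl, hl'⟩ |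
      ⟨p, q, v, u, v', u', hr, hv, hv', rfl, rfl, hl, hl'⟩
    · exact .inl ⟨w₁ ++ emb s t p, emb s t q ++ w₂, cond a s t, i,
        by simp [emb_append, embLetter], by simp [emb_append]⟩
    · refine .inr (.inl ⟨w₁ ++ emb s t p, emb s t q ++ w₂, _, _, hr.emb hst hm, ?_⟩)
      rcases h with ⟨rfl, rfl⟩ | ⟨rfl, rfl⟩
      · exact .inl ⟨by simp [emb_append], by simp [emb_append]⟩
      · exact .inr ⟨by simp [emb_append, emb_wordInv], by simp [emb_append, emb_wordInv]⟩
    · have hr' := hr.emb hst hm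
      rw [emb_append, emb_append] at hr'
      refine .inr (.inr (.inl ⟨w₁ ++ emb s t p, emb s t q ++ w₂, _, _, _, _, hr',
        by simpa [emb] using hv, by simpa [emb] using hv', by simp [emb_append, emb_wordInv],
        by simp [emb_append, emb_wordInv], ?_, ?_⟩))
      · rw [isLCPrefix_iff] at hl ⊢
        rw [wordInv_append, ← emb_wordInv]
        exact no_common_head_emb hst h₁.wordInv hl
      · rw [isLCPrefix_iff] at hl' ⊢
        exact no_common_head_emb hst h₂ hl'
    · have hr' := hr.emb hst hm
      rw [emb_append, emb_append] at hr'
      refine .inr (.inr (.inr ⟨w₁ ++ emb s t p, emb s t q ++ w₂, _, _, _, _, hr',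
        by simpa [emb] using hv, by simpa [emb] using hv', by simp [emb_append, emb_wordInv],
        by simp [emb_append, emb_wordInv], ?_, ?_⟩))
      · rw [isLCSuffix_iff] at hl ⊢
        exact no_common_last_emb hst h₁ hl
      · rw [isLCSuffix_iff] at hl' ⊢
        rw [wordInv_append, ← emb_wordInv]
        exact no_common_last_emb hst h₂.wordInv hl'

end emb

/-! ### Alternating words in the dihedral case -/

/-- The letter at position `c` of an alternating sequence starting with `a`. -/
def altAt (a : Bool) : ℕ → Bool
  | 0 => a
  | c + 1 => altAt (!a) c

@[simp] lemma altAt_zero (a : Bool) : altAt a 0 = a := rfl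

lemma altAt_not (a : Bool) (c : ℕ) : altAt (!a) c = !altAt a c := by
  induction c generalizing a with
  | zero => rfl
  | succ c ih => simp only [altAt, ih]

@[simp] lemma altAt_succ (a : Bool) (c : ℕ) : altAt a (c + 1) = !altAt a c := altAt_not a c

lemma altAt_add (a : Bool) (c d : ℕ) : altAt a (c + d) = altAt (altAt a c) d := by
  induction d with
  | zero => rfl
  | succ d ih => simp [← Nat.add_assoc, ih]

@[simp] lemma altAt_altAt (a : Bool) (c : ℕ) : altAt (altAt a c) c = a := by
  induction c with
  | zero => rfl
  | succ c ih => simp [altAt_not, ih]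

/-- The alternating word of length `c` with constant sign `i`, beginning with `a`. -/
def salt (i a : Bool) : ℕ → Word Bool
  | 0 => []
  | c + 1 => (a, i) :: salt i (!a) c

@[simp] lemma salt_zero (i a : Bool) : salt i a 0 = [] := rfl

lemma salt_succ (i a : Bool) (c : ℕ) : salt i a (c + 1) = (a, i) :: salt i (!a) c := rfl

lemma altWord_eq_salt (a : Bool) (c : ℕ) : altWord a (!a) c = salt true a c := by
  induction c generalizing a with
  | zero => rfl
  | succ c ih => simp [altWord, salt, ← ih]

@[simp] lemma salt_length (i a : Bool) (c : ℕ) : (salt i a c).length = c := by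
  induction c generalizing a with
  | zero => rfl
  | succ c ih => simp [salt, ih]

lemma salt_add (i a : Bool) (c d : ℕ) :
    salt i a (c + d) = salt i a c ++ salt i (altAt a c) d := by
  induction c generalizing a with
  | zero => simp
  | succ c ih => simp [Nat.add_right_comm, salt_succ, ih, altAt_not]

lemma salt_succ' (i a : Bool) (c : ℕ) : salt i a (c + 1) = salt i a c ++ [(altAt a c, i)] := by
  rw [salt_add]; rfl

lemma wordInv_salt (i a : Bool) (c : ℕ) :
    wordInv (salt i a c) = salt (!i) (!altAt a c) c := by
  induction c with
  | zero => rfl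
  | succ c ih => rw [salt_succ', wordInv_append, ih, altAt_succ, salt_succ]; simp [wordInv]

lemma salt_head? (i a : Bool) {c : ℕ} (hc : c ≠ 0) : (salt i a c).head? = some (a, i) := by
  cases c <;> simp_all [salt]

lemma salt_getLast? (i a : Bool) {c : ℕ} (hc : c ≠ 0) :
    (salt i a c).getLast? = some (!altAt a c, i) := by
  cases c <;> simp_all [salt_succ']

lemma isRel_dih {M : ℕ} (hM : 3 ≤ M) (a : Bool) :
    IsRel (dih M hM) (salt true a M) (salt true (!a) M) :=
  ⟨a, !a, M, by cases a <;> simp, rfl, (altWord_eq_salt a M).symm, by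
    rw [← altWord_eq_salt, Bool.not_not]⟩

/-! ### A normal form for dihedral elements -/

/-- Normal forms of dihedral elements: a sequence of alternating blocks of the given lengths,
the first one starting with `e`, and a power of the Garside element. -/
inductive DState
  | emp (r : ℤ)
  | ne (j : ℕ) (l : List ℕ) (e : Bool) (r : ℤ)

namespace DState

/-- The normal form with blocks `l`, first letter `e` and Garside exponent `r`. -/
def pop : List ℕ → Bool → ℤ → DState
  | [], _, r => emp r
  | j :: l, e, r => ne j l e r

/-- The block lengths. -/
def entries : DState → List ℕ
  | emp _ => []
  | ne j l _ _ => j :: l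

/-- The Garside exponent. -/
def exp : DState → ℤ
  | emp r => r
  | ne _ _ _ r => r

@[simp] lemma entries_emp (r : ℤ) : (emp r).entries = [] := rfl
@[simp] lemma entries_ne (j l e r) : (ne j l e r).entries = j :: l := rfl
@[simp] lemma exp_emp (r : ℤ) : (emp r).exp = r := rfl
@[simp] lemma exp_ne (j l e r) : (ne j l e r).exp = r := rfl
@[simp] lemma entries_pop (l e r) : (pop l e r).entries = l := by cases l <;> rfl
@[simp] lemma exp_pop (l e r) : (pop l e r).exp = r := by cases l <;> rfl
@[simp] lemma pop_cons (j l e r) : pop (j :: l) e r = ne j l e r := rfl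
@[simp] lemma pop_nil (e r) : pop [] e r = emp r := rfl

/-- Every block is a proper factor of the Garside element. -/
def Valid (M : ℕ) (q : DState) : Prop := ∀ j ∈ q.entries, 1 ≤ j ∧ j < M

/-- The action of a letter on normal forms. -/
def act (M : ℕ) : Bool × Bool → DState → DState
  | (a, true), emp r => ne 1 [] a r
  | (a, true), ne j l e r =>
    if a = e then ne 1 (j :: l) e r else if j + 1 = M then pop l e (r + 1) else ne (j + 1) l a r
  | (a, false), emp r => ne (M - 1) [] (!a) (r - 1)
  | (a, false), ne j l e r =>
    if a = e then (if j = 1 then pop l e r else ne (j - 1) l (!e) r)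
    else ne (M - 1) (j :: l) e (r - 1)

lemma Valid.act {M : ℕ} (hM : 3 ≤ M) {q : DState} (h : q.Valid M) (x : Bool × Bool) :
    (act M x q).Valid M := by
  obtain ⟨a, i⟩ := x
  cases q <;> cases i <;> simp only [DState.act] <;> (try split_ifs) <;>
    simp_all [Valid] <;> lia

lemma act_letterInv {M : ℕ} (hM : 3 ≤ M) {q : DState} (h : q.Valid M) (x : Bool × Bool) :
    act M x (act M (letterInv x) q) = q := by
  have hM' : M - 1 + 1 = M := by lia
  obtain ⟨a, i⟩ := x
  cases q with
  | emp r => cases i <;> cases a <;> simp [act, letterInv, hM']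
  | ne j l e r =>
    have hj : 1 ≤ j ∧ j < M := h j (by simp)
    have h1 : M - 1 ≠ 1 := by lia
    by_cases hae : a = e
    · subst hae
      cases i
      · simp [act, letterInv]
      · by_cases hj1 : j = 1
        · subst hj1
          cases l <;> simp [act, letterInv]
        · have h2 : j - 1 + 1 = j := by lia
          have h3 : j ≠ M := by lia
          simp [act, letterInv, hj1, h2, h3]
    · obtain rfl : e = !a := by cases a <;> cases e <;> simp_all
      cases i
      · by_cases hj1 : j + 1 = M
        · have h2 : M - 1 = j := by lia
          cases l <;> simp [act, letterInv, hj1, h2]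
        · have h2 : j ≠ 0 := by lia
          simp [act, letterInv, hj1, h2]
      · simp [act, letterInv, hM']

end DState

open DState

/-- The action of a word on normal forms. -/
def run (M : ℕ) (w : Word Bool) (q : DState) : DState := w.foldr (act M) q

@[simp] lemma run_nil (M : ℕ) (q : DState) : run M [] q = q := rfl

@[simp] lemma run_cons (M : ℕ) (x : Bool × Bool) (w : Word Bool) (q : DState) :
    run M (x :: w) q = act M x (run M w q) := rfl

lemma run_append (M : ℕ) (u v : Word Bool) (q : DState) :
    run M (u ++ v) q = run M u (run M v q) := foldr_append

section braid
variable {M : ℕ} (hM : 3 ≤ M)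
include hM

lemma valid_run {q : DState} (h : q.Valid M) (w : Word Bool) : (run M w q).Valid M := by
  induction w with
  | nil => exact h
  | cons x w ih => exact ih.act hM x

lemma valid_run_emp (w : Word Bool) (r : ℤ) : (run M w (emp r)).Valid M :=
  valid_run hM (by simp [Valid]) w

omit hM in
/-- An alternating word pushes a new block onto a normal form whose first letter repeats its
last letter. -/
lemma run_salt_push (a : Bool) (l : List ℕ) (r : ℤ) {c : ℕ} (hc : c + 1 < M) :
    run M (salt true a (c + 1)) (pop l (altAt a c) r) = ne (c + 1) l a r := by
  induction c generalizing a with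
  | zero => cases l <;> simp [salt, act]
  | succ c ih =>
    rw [salt_succ, run_cons, altAt, ih _ (by lia)]
    cases a <;> simp [act, hc.ne]

lemma run_salt_push_full (a : Bool) (l : List ℕ) (r : ℤ) :
    run M (salt true a M) (pop l (!altAt a M) r) = pop l (!a) (r + 1) := by
  obtain ⟨c, rfl⟩ : ∃ c, M = c + 1 + 1 := ⟨M - 2, by lia⟩
  rw [salt_succ, run_cons, show (!altAt a (c + 1 + 1)) = altAt (!a) c by
    simp [altAt_not], run_salt_push _ _ _ (by lia)]
  cases a <;> simp [act]

omit hM in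
lemma run_salt_extend (a : Bool) (j : ℕ) (l : List ℕ) (r : ℤ) {c : ℕ} (hc : j + c < M) :
    run M (salt true a c) (ne j l (altAt a c) r) = ne (j + c) l a r := by
  induction c generalizing a with
  | zero => simp
  | succ c ih =>
    rw [salt_succ, run_cons, altAt, ih _ (by lia)]
    have : j + (c + 1) ≠ M := by lia
    cases a <;> simp [act, this, Nat.add_assoc]

lemma run_garside (a : Bool) {q : DState} (hq : q.Valid M) :
    run M (salt true a M) q = run M (salt true (!a) M) q := by
  have key (a : Bool) (j l r) (hj : 1 ≤ j ∧ j < M) :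
      run M (salt true a M) (ne j l (altAt a M) r) = ne j l a (r + 1) := by
    obtain ⟨c, rfl⟩ : ∃ c, M = j + (c + 1) := ⟨M - j - 1, by lia⟩
    rw [salt_add, run_append, salt_succ, run_cons]
    have h1 : altAt a (j + (c + 1)) = altAt (!altAt a j) c := by
      rw [altAt_add]; rfl
    rw [h1, run_salt_extend _ _ _ _ (by lia)]
    have h2 : act (j + (c + 1)) (altAt a j, true) (ne (j + c) l (!altAt a j) r) =
        pop l (!altAt a j) (r + 1) := by
      simp [act, Nat.add_assoc]
    rw [h2]
    obtain ⟨d, rfl⟩ : ∃ d, j = d + 1 := ⟨j - 1, by lia⟩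
    rw [altAt_succ, Bool.not_not, run_salt_push _ _ _ (by lia)]
  cases q with
  | emp r =>
    have h1 := run_salt_push_full hM a [] r
    have h2 := run_salt_push_full hM (!a) [] r
    simp only [pop_nil] at h1 h2
    rw [h1, h2]
  | ne j l e r =>
    have hj := hq j (by simp)
    by_cases he : e = altAt a M
    · subst he
      have h2 := run_salt_push_full hM (!a) (j :: l) r
      simp only [pop_cons, altAt_not, Bool.not_not] at h2
      rw [key a j l r hj, h2]
    · obtain rfl : e = !altAt a M := by cases h : altAt a M <;> simp_all
      have h1 := run_salt_push_full hM a (j :: l) r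
      simp only [pop_cons] at h1
      rw [h1, ← altAt_not, key (!a) j l r hj]

/-- The permutation of valid normal forms induced by a generator. -/
def statePerm (a : Bool) : Equiv.Perm {q : DState // q.Valid M} where
  toFun q := ⟨act M (a, true) q, q.2.act hM _⟩
  invFun q := ⟨act M (a, false) q, q.2.act hM _⟩
  left_inv q := Subtype.ext (act_letterInv hM q.2 (a, false))
  right_inv q := Subtype.ext (act_letterInv hM q.2 (a, true))

lemma evalWord_statePerm (w : Word Bool) (q : {q : DState // q.Valid M}) :
    (evalWord (statePerm hM) w q : DState) = run M w q := by
  induction w with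
  | nil => rfl
  | cons x w ih =>
    obtain ⟨a, i⟩ := x
    rw [evalWord_cons, Equiv.Perm.mul_apply, run_cons, ← ih]
    cases i <;> rfl

/-- Equal dihedral elements act equally on normal forms. -/
lemma run_eq_of_wbar_eq {x y : Word Bool} (h : wbar (dih M hM) x = wbar (dih M hM) y)
    {q : DState} (hq : q.Valid M) : run M x q = run M y q := by
  obtain ⟨φ, hφ⟩ := exists_hom (A := dih M hM) (statePerm hM) (by
    intro s t k hst hk
    have hk' : (M : ℕ∞) = k := hk
    obtain rfl : M = k := by exact_mod_cast hk'
    obtain rfl : t = !s := by cases s <;> cases t <;> simp_all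
    ext q
    have := run_garside hM s q.2
    rw [evalWord_statePerm, evalWord_statePerm, altWord_eq_salt, this, ← altWord_eq_salt,
      Bool.not_not])
  have := hφ x
  rw [h, hφ] at this
  rw [← evalWord_statePerm hM x ⟨q, hq⟩, ← evalWord_statePerm hM y ⟨q, hq⟩, this]

end braid

/-! ### A family of lower bounds for the length -/

/-- An integer-valued function on normal forms that every letter changes by `±1`. -/
def pot (M : ℕ) (θ : ℤ) (q : DState) : ℤ :=
  (q.entries.map fun j : ℕ => min (j : ℤ) (2 * θ - j)).sum + (2 * θ - M) * q.exp

section pot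
variable {M : ℕ} {θ : ℤ} (h0 : 0 ≤ θ) (hθ : θ ≤ M) {q : DState}
include h0 hθ

lemma pot_act (hM : 3 ≤ M) (hq : q.Valid M) (x : Bool × Bool) :
    pot M θ (act M x q) = pot M θ q + 1 ∨ pot M θ (act M x q) = pot M θ q - 1 := by
  have h1 : ((M - 1 : ℕ) : ℤ) = M - 1 := by push_cast [show 1 ≤ M by lia]; ring
  obtain ⟨a, i⟩ := x
  cases q with
  | emp r =>
    cases i <;> simp only [act, pot, entries_emp, exp_emp, entries_ne, exp_ne, map_cons, map_nil,
      sum_cons, sum_nil, h1, mul_sub] <;> push_cast <;> omega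
  | ne j l e r =>
    have hj : 1 ≤ j ∧ j < M := hq j (by simp)
    cases i <;> simp only [act] <;> split_ifs <;>
      simp only [pot, entries_ne, exp_ne, map_cons, sum_cons, h1, mul_sub,
        mul_add, entries_pop, exp_pop] <;> push_cast <;> omega

lemma pot_act_or (hM : 3 ≤ M) (hq : q.Valid M) (x : Bool × Bool) :
    pot M θ (act M x q) = pot M θ q + 1 ∨ pot M θ (act M (letterInv x) q) = pot M θ q + 1 := by
  have h1 : ((M - 1 : ℕ) : ℤ) = M - 1 := by push_cast [show 1 ≤ M by lia]; ring
  obtain ⟨a, i⟩ := x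
  cases q with
  | emp r =>
    cases i <;> simp only [act, letterInv, Bool.not_true, Bool.not_false, pot, entries_emp,
      exp_emp, entries_ne, exp_ne, map_cons, map_nil,
      sum_cons, sum_nil, h1, mul_sub] <;> push_cast <;> omega
  | ne j l e r =>
    have hj : 1 ≤ j ∧ j < M := hq j (by simp)
    cases i <;> simp only [act, letterInv, Bool.not_true, Bool.not_false] <;> split_ifs <;>
      simp only [pot, entries_ne, exp_ne, map_cons, sum_cons, h1, mul_sub,
        mul_add, entries_pop, exp_pop] <;> push_cast <;> omega

end pot

section geodesic
variable {M : ℕ} (hM : 3 ≤ M)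
include hM

lemma pot_run_le {θ : ℤ} (h0 : 0 ≤ θ) (hθ : θ ≤ M) (w : Word Bool) :
    pot M θ (run M w (emp 0)) ≤ w.length := by
  induction w with
  | nil => simp [pot]
  | cons x w ih =>
    have := pot_act h0 hθ hM (valid_run_emp hM w 0) x
    rw [run_cons, length_cons]
    push_cast
    lia

lemma geodesic_of_pot {θ : ℤ} (h0 : 0 ≤ θ) (hθ : θ ≤ M) {w : Word Bool}
    (h : pot M θ (run M w (emp 0)) = w.length) : Geodesic (dih M hM) w := by
  intro w' hw
  have h1 := pot_run_le hM h0 hθ w'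
  rw [run_eq_of_wbar_eq hM hw (by simp [Valid]), h] at h1
  exact_mod_cast h1

lemma parity_of_wbar_eq {x y : Word Bool} (h : wbar (dih M hM) x = wbar (dih M hM) y) :
    x.length % 2 = y.length % 2 := by
  have key (w : Word Bool) : pot M 0 (run M w (emp 0)) % 2 = (w.length : ℤ) % 2 := by
    induction w with
    | nil => simp [pot]
    | cons x w ih =>
      have := pot_act le_rfl (by positivity) hM (valid_run_emp hM w 0) x
      rw [run_cons, length_cons]
      push_cast
      lia
  have h1 := key x
  rw [run_eq_of_wbar_eq hM h (by simp [Valid]), key y] at h1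
  lia

end geodesic

/-! ### Block words -/

/-- The word with first block parameter `e` whose blocks are positive alternating words of
length `j` for entries `(j, true)` and negative ones of length `M - j` for `(j, false)`. -/
def bword (M : ℕ) : Bool → List (ℕ × Bool) → Word Bool
  | _, [] => []
  | e, (j, true) :: L => salt true e j ++ bword M (!altAt e j) L
  | e, (j, false) :: L => salt false (!e) (M - j) ++ bword M (!altAt e (M - j)) L

/-- All blocks are proper and non-empty. -/
def BValid (M : ℕ) (L : List (ℕ × Bool)) : Prop := ∀ b ∈ L, 1 ≤ b.1 ∧ b.1 < M

/-- The letter is a possible first letter of a block word with parameter `e`. -/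
def Fits (e : Bool) (c : Bool × Bool) : Prop := c.1 = (e == c.2)

section bword
variable {M : ℕ}

@[simp] lemma bword_nil (e : Bool) : bword M e [] = [] := rfl

lemma bword_cons_true (e : Bool) (j : ℕ) (L) :
    bword M e ((j, true) :: L) = salt true e j ++ bword M (!altAt e j) L := rfl

lemma bword_cons_false (e : Bool) (j : ℕ) (L) :
    bword M e ((j, false) :: L) = salt false (!e) (M - j) ++ bword M (!altAt e (M - j)) L := rfl

lemma bvalid_cons {b : ℕ × Bool} {L} : BValid M (b :: L) ↔ (1 ≤ b.1 ∧ b.1 < M) ∧ BValid M L := by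
  simp [BValid]

lemma fits_bword {e : Bool} {L} (hL : BValid M L) {c} (hc : (bword M e L).head? = some c) :
    Fits e c := by
  rcases L with _ | ⟨⟨j, i⟩, L⟩
  · simp at hc
  · have hj := (bvalid_cons.1 hL).1
    simp only at hj
    cases i
    · rw [bword_cons_false, head?_append_of_ne_nil _ (by
        rw [← length_pos_iff, salt_length]; lia), salt_head? _ _ (by lia)] at hc
      obtain rfl := by simpa using hc
      simp [Fits]
    · rw [bword_cons_true, head?_append_of_ne_nil _ (by
        rw [← length_pos_iff, salt_length]; lia), salt_head? _ _ (by lia)] at hc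
      obtain rfl := by simpa using hc
      simp [Fits]

lemma bword_length (e : Bool) (L) :
    (bword M e L).length = (L.map fun b => cond b.2 b.1 (M - b.1)).sum := by
  induction L generalizing e with
  | nil => rfl
  | cons b L ih =>
    obtain ⟨j, i⟩ := b
    cases i <;> simp [bword, ih]

lemma run_salt_false_push (e : Bool) (l : List ℕ) (r : ℤ) {c : ℕ} (hc : c + 1 < M) :
    run M (salt false (!e) (c + 1)) (pop l (!altAt e (c + 1)) r) =
      ne (M - (c + 1)) l e (r - 1) := by
  induction c generalizing e with
  | zero => cases l <;> simp [salt, act]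
  | succ c ih =>
    rw [salt_succ, run_cons, altAt, ih _ (by lia)]
    have : M - (c + 1) ≠ 1 := by lia
    simp [act, this, ← Nat.sub_add_eq]

lemma run_bword (e : Bool) {L} (hL : BValid M L) (r : ℤ) :
    run M (bword M e L) (emp r) = pop (L.map Prod.fst) e (r - (L.map Prod.snd).count false) := by
  induction L generalizing e with
  | nil => simp
  | cons b L ih =>
    obtain ⟨j, i⟩ := b
    obtain ⟨hj, hL'⟩ := bvalid_cons.1 hL
    simp only at hj
    cases i
    · obtain ⟨c, hc⟩ : ∃ c, M - j = c + 1 := ⟨M - j - 1, by lia⟩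
      have h2 : M - (c + 1) = j := by lia
      rw [bword_cons_false, run_append, ih _ hL', hc, run_salt_false_push _ _ _ (by lia), h2]
      simp
      ring
    · obtain ⟨c, rfl⟩ : ∃ c, j = c + 1 := ⟨j - 1, by lia⟩
      rw [bword_cons_true, run_append, ih _ hL', altAt_succ, Bool.not_not,
        run_salt_push _ _ _ (by lia)]
      simp

lemma pot_bword (e : Bool) {L} (hL : BValid M L) {θ : ℤ} (hp : ∀ j, (j, true) ∈ L → (j : ℤ) ≤ θ)
    (hn : ∀ j, (j, false) ∈ L → θ ≤ j) :
    pot M θ (run M (bword M e L) (emp 0)) = (bword M e L).length := by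
  rw [run_bword e hL, pot, entries_pop, exp_pop, bword_length]
  induction L with
  | nil => simp
  | cons b L ih =>
    obtain ⟨j, i⟩ := b
    obtain ⟨hj, hL⟩ := bvalid_cons.1 hL
    have := ih hL (fun j h => hp j (mem_cons_of_mem _ h)) (fun j h => hn j (mem_cons_of_mem _ h))
    simp only at hj
    cases i
    · have h1 := hn j (by simp)
      have h2 : ((M - j : ℕ) : ℤ) = M - j := by push_cast [hj.2.le]; ring
      simp only [map_cons, sum_cons, count_cons_self, cond_false, Nat.cast_add, ← this, h2,
        min_eq_right (show 2 * θ - j ≤ (j : ℤ) by lia)]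
      push_cast
      ring
    · have h1 := hp j (by simp)
      simp only [map_cons, sum_cons, cond_true, Nat.cast_add, ← this,
        min_eq_left (show (j : ℤ) ≤ 2 * θ - j by lia)]
      simp
      ring

/-- Every dihedral word contains a Garside factor or a cancelling pair or is a block word. -/
lemma exists_bword (hM : 3 ≤ M) (w : Word Bool) :
    (∃ u v i a, w = u ++ salt i a M ++ v) ∨ (∃ u x v, w = u ++ x :: letterInv x :: v) ∨
      ∃ e L, BValid M L ∧ w = bword M e L := by
  induction w with
  | nil => exact .inr (.inr ⟨true, [], by simp [BValid], rfl⟩)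
  | cons x w ih =>
    rcases ih with ⟨u, v, i, a, rfl⟩ | ⟨u, y, v, rfl⟩ | ⟨e, L, hL, rfl⟩
    · exact .inl ⟨x :: u, v, i, a, rfl⟩
    · exact .inr (.inl ⟨x :: u, y, v, rfl⟩)
    obtain ⟨a, i⟩ := x
    have h1 : M - (M - 1) = 1 := by lia
    have hnew (h : Fits e (a, i)) : ∃ e' L', BValid M L' ∧
        (a, i) :: bword M e L = bword M e' L' := by
      cases i
      · obtain rfl : a = !e := by simpa [Fits] using h
        refine ⟨e, (M - 1, false) :: L, bvalid_cons.2 ⟨⟨?_, ?_⟩, hL⟩, ?_⟩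
        · change 1 ≤ M - 1; lia
        · change M - 1 < M; lia
        · simp [bword, h1, salt]
      · obtain rfl : a = e := by simpa [Fits] using h
        refine ⟨a, (1, true) :: L, bvalid_cons.2 ⟨⟨le_rfl, ?_⟩, hL⟩, ?_⟩
        · change 1 < M; lia
        · simp [bword, salt]
    by_cases hf : Fits e (a, i)
    · exact .inr (.inr (hnew hf))
    rcases L with _ | ⟨⟨j, i'⟩, L⟩
    · refine .inr (.inr ?_)
      refine ⟨(a == i), [(cond i 1 (M - 1), i)], ?_, ?_⟩
      · intro b hb
        obtain rfl := by simpa using hb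
        cases i <;> simp <;> lia
      · cases i <;> simp [bword, salt, h1]
    obtain ⟨hj, hL'⟩ := bvalid_cons.1 hL
    simp only at hj
    cases i <;> cases i'
    · obtain rfl : a = e := by cases a <;> cases e <;> simp [Fits] at hf <;> rfl
      by_cases hj1 : j = 1
      · obtain ⟨c, rfl⟩ : ∃ c, M = c + 1 := ⟨M - 1, by lia⟩
        subst hj1
        exact .inl ⟨[], _, false, a, by
          rw [bword_cons_false, salt_succ, Nat.add_sub_cancel]; simp; rfl⟩
      · refine .inr (.inr ⟨!a, (j - 1, false) :: L, bvalid_cons.2 ⟨⟨?_, ?_⟩, hL'⟩, ?_⟩)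
        · change 1 ≤ j - 1; lia
        · change j - 1 < M; lia
        · have h2 : M - (j - 1) = M - j + 1 := by lia
          rw [bword_cons_false, bword_cons_false, h2, Bool.not_not, salt_succ]
          simp [altAt_not]
    · obtain rfl : a = e := by cases a <;> cases e <;> simp [Fits] at hf <;> rfl
      obtain ⟨c, rfl⟩ : ∃ c, j = c + 1 := ⟨j - 1, by lia⟩
      exact .inr (.inl ⟨[], (a, false), _, by rw [bword_cons_true, salt_succ]; rfl⟩)
    · obtain rfl : a = !e := by cases a <;> cases e <;> simp [Fits] at hf <;> rfl
      obtain ⟨c, hc⟩ : ∃ c, M - j = c + 1 := ⟨M - j - 1, by lia⟩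
      exact .inr (.inl ⟨[], (!e, true), _, by rw [bword_cons_false, hc, salt_succ]; rfl⟩)
    · obtain rfl : a = !e := by cases a <;> cases e <;> simp [Fits] at hf <;> rfl
      by_cases hj1 : j + 1 = M
      · refine .inl ⟨[], bword M (!altAt e j) L, true, !e, ?_⟩
        rw [← hj1, salt_succ, Bool.not_not]
        rfl
      · refine .inr (.inr ⟨!e, (j + 1, true) :: L, bvalid_cons.2 ⟨⟨?_, ?_⟩, hL'⟩, ?_⟩)
        · change 1 ≤ j + 1; lia
        · change j + 1 < M; lia
        · rw [bword_cons_true, bword_cons_true, salt_succ, Bool.not_not]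
          simp [altAt_not]

end bword

/-! ### Exchanging the signs of blocks -/

section swap
variable {M : ℕ} (hM : 3 ≤ M)

/-- The last letter of the word, if any, is compatible with a following block word. -/
def Sep (e : Bool) (w : Word Bool) : Prop := ∀ c, w.getLast? = some c → Fits e c

lemma sep_true {e : Bool} {j : ℕ} (hj : 1 ≤ j) (w : Word Bool) :
    Sep (!altAt e j) (w ++ salt true e j) := by
  intro c hc
  rw [getLast?_append_of_ne_nil _ (by rw [← length_pos_iff, salt_length]; lia),
    salt_getLast? _ _ (by lia)] at hc
  obtain rfl := by simpa using hc
  simp [Fits]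

lemma sep_false {e : Bool} {j : ℕ} (hj : j < M) (w : Word Bool) :
    Sep (!altAt e (M - j)) (w ++ salt false (!e) (M - j)) := by
  intro c hc
  rw [getLast?_append_of_ne_nil _ (by rw [← length_pos_iff, salt_length]; lia),
    salt_getLast? _ _ (by lia)] at hc
  obtain rfl := by simpa using hc
  simp [Fits, altAt_not]

lemma Sep.head? {e : Bool} {w : Word Bool} (h : Sep e w) {c} (hc : (wordInv w).head? = some c) :
    Fits e (letterInv c) := by
  simp only [wordInv, head?_map, head?_reverse, Option.map_eq_some_iff] at hc
  obtain ⟨a, ha, rfl⟩ := hc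
  simpa [letterInv] using h a ha

lemma getLast?_wordInv {w : Word Bool} {c} (hc : (wordInv w).getLast? = some c) :
    w.head? = some (letterInv c) := by
  simp only [wordInv, getLast?_map, getLast?_reverse, Option.map_eq_some_iff] at hc
  obtain ⟨a, ha, rfl⟩ := hc
  simpa [letterInv] using ha

lemma steps_swap {e : Bool} {w : Word Bool} (hw : Sep e w) {j₁ j₂ : ℕ} {L} (h₁ : 1 ≤ j₁ ∧ j₁ < M)
    (h₂ : 1 ≤ j₂ ∧ j₂ < M) (hL : BValid M L) :
    Step2rStar (dih M hM) (w ++ bword M e ((j₁, false) :: (j₂, true) :: L))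
        (w ++ bword M e ((j₁, true) :: (j₂, false) :: L)) ∧
      Step2lStar (dih M hM) (w ++ bword M e ((j₁, true) :: (j₂, false) :: L))
        (w ++ bword M e ((j₁, false) :: (j₂, true) :: L)) := by
  obtain ⟨c, rfl⟩ : ∃ c, M = c + j₁ := ⟨M - j₁, by lia⟩
  obtain ⟨d, hd⟩ : ∃ d, c + j₁ = j₂ + d := ⟨c + j₁ - j₂, by lia⟩
  have hd' : c + j₁ - j₂ = d := by lia
  set z := altAt e c with hz
  have hze : altAt z c = e := by simp [hz]
  set f := altAt (!z) j₂ with hf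
  have hfd : altAt f d = !altAt e j₁ := by
    rw [hf, ← altAt_add, ← hd, altAt_add, altAt_not, hze, altAt_not]
  have hfd' : altAt (!altAt e j₁) d = f := by rw [← hfd, altAt_altAt]
  have hx : bword (c + j₁) e ((j₁, false) :: (j₂, true) :: L) =
      wordInv (salt true z c) ++ (salt true (!z) j₂ ++ bword (c + j₁) (!f) L) := by
    rw [bword_cons_false, bword_cons_true, wordInv_salt, hze, Nat.add_sub_cancel, Bool.not_true]
  have hy : bword (c + j₁) e ((j₁, true) :: (j₂, false) :: L) =
      salt true e j₁ ++ (wordInv (salt true f d) ++ bword (c + j₁) (!f) L) := by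
    rw [bword_cons_true, bword_cons_false, wordInv_salt, hfd, hd', Bool.not_true, hfd']
  have hne {i a} {n : ℕ} (hn : n ≠ 0) : salt i a n ≠ [] := by
    rw [← length_pos_iff, salt_length]; lia
  have hr := isRel_dih hM z
  have hs : salt true (!z) (c + j₁) = salt true (!z) j₂ ++ salt true f d := by rw [hd, salt_add]
  rw [salt_add true z, hze, hs] at hr
  rw [hx, hy]
  refine ⟨⟨w, bword (c + j₁) (!f) L, salt true z c, salt true e j₁, salt true (!z) j₂,
    salt true f d, hr, hne (by lia), hne (by lia), by simp, by simp, ?_, ?_⟩,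
    ⟨w, bword (c + j₁) (!f) L, salt true e j₁, salt true z c, salt true f d, salt true (!z) j₂,
      hr, hne (by lia), hne (by lia), by simp, by simp, ?_, ?_⟩⟩
  · rw [isLCPrefix_iff]
    intro x hx hx'
    rw [salt_head? _ _ (by lia)] at hx
    obtain rfl := by simpa using hx
    have := hw.head? hx'
    simp [Fits, letterInv] at this
  · rw [isLCPrefix_iff]
    intro x hx hx'
    rw [salt_head? _ _ (by lia)] at hx
    obtain rfl := by simpa using hx
    have := fits_bword hL hx'
    simp [Fits] at this
  · rw [isLCSuffix_iff]
    intro x hx hx'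
    rw [salt_getLast? _ _ (by lia), hze] at hx
    obtain rfl := by simpa using hx
    have := hw _ hx'
    simp [Fits] at this
  · rw [isLCSuffix_iff]
    intro x hx hx'
    rw [salt_getLast? _ _ (by lia), ← hf] at hx
    obtain rfl := by simpa using hx
    have := fits_bword hL (getLast?_wordInv hx')
    simp [Fits, letterInv] at this

lemma steps_of_perm {σ σ' : List Bool} (h : σ.Perm σ') {e : Bool} {w : Word Bool} (hw : Sep e w)
    {l : List ℕ} (hl : ∀ j ∈ l, 1 ≤ j ∧ j < M) (hlen : l.length = σ.length) :
    Steps012Star (dih M hM) (w ++ bword M e (l.zip σ)) (w ++ bword M e (l.zip σ')) := by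
  have hv {l : List ℕ} (hl : ∀ j ∈ l, 1 ≤ j ∧ j < M) (σ : List Bool) : BValid M (l.zip σ) :=
    fun b hb => hl _ (of_mem_zip hb).1
  induction h generalizing e w l with
  | nil => exact .refl
  | cons i h ih =>
    rcases l with _ | ⟨j, l⟩
    · exact .refl
    have hj := hl j (by simp)
    have hl' : ∀ j ∈ l, 1 ≤ j ∧ j < M := fun j h => hl j (by simp [h])
    simp only [zip_cons_cons]
    cases i
    · simpa [bword_cons_false] using
        ih (sep_false (e := e) hj.2 w) hl' (by simpa using hlen)
    · simpa [bword_cons_true] using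
        ih (sep_true (e := e) hj.1 w) hl' (by simpa using hlen)
  | swap i i' σ =>
    match l with
    | [] => simp at hlen
    | [j] => simp at hlen
    | j :: j' :: l =>
      have h1 := hl j (by simp)
      have h2 := hl j' (by simp)
      have hl' : ∀ j ∈ l, 1 ≤ j ∧ j < M := fun j h => hl j (by simp [h])
      have := steps_swap hM hw h1 h2 (hv hl' σ)
      simp only [zip_cons_cons]
      cases i <;> cases i'
      · exact .refl
      · exact .single (.inr (.inr (.inr this.2)))
      · exact .single (.inr (.inr (.inl this.1)))
      · exact .refl
  | trans h h' ih ih' => exact (ih hw hl hlen).trans (ih' hw hl (hlen.trans h.length_eq))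

lemma steps_bword {L L' : List (ℕ × Bool)} (hL : BValid M L) (h : L.map Prod.fst = L'.map Prod.fst)
    (h' : (L.map Prod.snd).Perm (L'.map Prod.snd)) (e : Bool) :
    Steps012Star (dih M hM) (bword M e L) (bword M e L') := by
  have key (L : List (ℕ × Bool)) : (L.map Prod.fst).zip (L.map Prod.snd) = L := by
    induction L <;> simp_all
  have := steps_of_perm hM h' (e := e) (w := []) (by simp [Sep]) (l := L.map Prod.fst)
    (by simp only [mem_map]; rintro j ⟨b, hb, rfl⟩; exact hL b hb) (by simp)
  rwa [key, h, key] at this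

lemma stuck_bword {e : Bool} {L} (hL : BValid M L) (h : Stuck (dih M hM) (bword M e L)) {p n : ℕ}
    (hp : (p, true) ∈ L) (hn : (n, false) ∈ L) : p ≤ n := by
  by_contra! hlt
  have hM' : p < M := (hL _ hp).2
  have perm {σ₁ σ₂ σ₃ : List Bool} {i : Bool} :
      (σ₁ ++ i :: (σ₂ ++ (!i) :: σ₃)).Perm (σ₁ ++ (!i) :: (σ₂ ++ i :: σ₃)) := by
    rw [perm_iff_count]
    intro a
    simp only [count_append, count_cons]
    lia
  obtain ⟨L₁, L₂, rfl⟩ := append_of_mem hp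
  have hcase : (n, false) ∈ L₁ ∨ (n, false) ∈ L₂ := by simpa using hn
  rcases hcase with hn | hn
  · obtain ⟨L₁, L₃, rfl⟩ := append_of_mem hn
    have := h _ (steps_bword hM (L' := L₁ ++ (n, true) :: (L₃ ++ (p, false) :: L₂)) hL (by simp)
      (by simpa using perm (i := false)) e)
    simp [bword_length] at this
    lia
  · obtain ⟨L₂, L₃, rfl⟩ := append_of_mem hn
    have := h _ (steps_bword hM (L' := L₁ ++ (p, false) :: (L₂ ++ (n, true) :: L₃)) hL (by simp)
      (by simpa using perm (i := true)) e)
    simp [bword_length] at this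
    lia

lemma pot_of_stuck_bword {e : Bool} {L} (hL : BValid M L) (h : Stuck (dih M hM) (bword M e L)) :
    ∃ θ : ℤ, 0 ≤ θ ∧ θ ≤ M ∧ pot M θ (run M (bword M e L) (emp 0)) = (bword M e L).length := by
  have hex : ∃ θ : ℕ, ∀ j, (j, true) ∈ L → j ≤ θ := ⟨M, fun j hj => (hL _ hj).2.le⟩
  have hle : Nat.find hex ≤ M := Nat.find_min' _ fun j hj => (hL _ hj).2.le
  refine ⟨Nat.find hex, by positivity, by exact_mod_cast hle, pot_bword e hL ?_ ?_⟩
  · intro j hj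
    exact_mod_cast Nat.find_spec hex j hj
  · intro n hn
    norm_cast
    by_contra! hlt
    exact Nat.find_min hex hlt fun j hj => stuck_bword hM hL h hj hn

end swap

/-! ### Words containing a Garside factor -/

/-- Every letter has sign `i`. -/
def ConstSign (i : Bool) (w : Word Bool) : Prop := ∀ l ∈ w, l.2 = i

lemma constSign_salt (i a : Bool) (c : ℕ) : ConstSign i (salt i a c) := by
  induction c generalizing a with
  | zero => simp [ConstSign]
  | succ c ih => simpa [salt, ConstSign] using ih (!a)

lemma constSign_append {i : Bool} {u v : Word Bool} :
    ConstSign i (u ++ v) ↔ ConstSign i u ∧ ConstSign i v := by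
  simp [ConstSign, or_imp, forall_and]

section garside
variable {M : ℕ} (hM : 3 ≤ M)

lemma step1_garside (u v : Word Bool) (i a a' : Bool) :
    Relation.ReflTransGen (Step1 (dih M hM)) (u ++ salt i a M ++ v) (u ++ salt i a' M ++ v) := by
  by_cases h : a' = a
  · rw [h]
  obtain rfl : a' = !a := by cases a <;> cases a' <;> simp_all
  refine .single ?_
  cases i
  · refine ⟨u, v, _, _, isRel_dih hM (altAt a M), .inr ?_⟩
    simp [wordInv_salt, altAt_not]
  · exact ⟨u, v, _, _, (isRel_dih hM a).symm, .inl ⟨rfl, rfl⟩⟩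

lemma steps_of_step1 {A : ArtinData S} {x y : Word S} (h : Relation.ReflTransGen (Step1 A) x y) :
    Steps012Star A x y := h.lift id fun _ _ h => .inr (.inl h)

lemma salt_garside_comm (i a : Bool) (c : ℕ) :
    salt i a c ++ [(altAt a c, i)] = (a, i) :: salt i (!a) c := by
  rw [← salt_succ', salt_succ]

lemma Stuck.constSign_right {i a : Bool} {u v : Word Bool}
    (h : Stuck (dih M hM) (u ++ salt i a M ++ v)) : ConstSign i v := by
  induction v generalizing u with
  | nil => simp [ConstSign]
  | cons x v ih =>
    obtain ⟨b, i'⟩ := x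
    by_cases hi : i' = i
    · subst hi
      have h' := h.of_steps (steps_of_step1 (step1_garside hM u _ i' a (altAt b M))) (by simp)
      have : u ++ salt i' (altAt b M) M ++ (b, i') :: v =
          (u ++ [(altAt b M, i')]) ++ salt i' (!altAt b M) M ++ v := by
        have := salt_garside_comm i' (altAt b M) M
        rw [altAt_altAt] at this
        simp only [append_assoc, singleton_append, ← this]
      rw [this] at h'
      intro l hl
      rcases mem_cons.1 hl with rfl | hl
      · rfl
      · exact ih (h'.of_steps (steps_of_step1 (step1_garside hM _ _ i' _ a)) (by simp)) l hl
    · obtain rfl : i' = !i := by cases i <;> cases i' <;> simp_all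
      have h' := h.of_steps (steps_of_step1 (step1_garside hM u _ i a (!altAt b M))) (by simp)
      obtain ⟨c, rfl⟩ : ∃ c, M = c + 1 := ⟨M - 1, by lia⟩
      rw [salt_succ'] at h'
      refine (Stuck.not_cancel (A := dih (c + 1) hM)
        (w₁ := u ++ salt i (!altAt b (c + 1)) c) (a := (b, i)) (w₂ := v)
        ?_).elim
      simpa [letterInv, altAt_not] using h'

lemma Stuck.constSign_left {i a : Bool} {u v : Word Bool}
    (h : Stuck (dih M hM) (u ++ salt i a M ++ v)) : ConstSign i u := by
  induction u using List.reverseRecOn generalizing v with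
  | nil => simp [ConstSign]
  | append_singleton u x ih =>
    obtain ⟨b, i'⟩ := x
    by_cases hi : i' = i
    · subst hi
      have h' := h.of_steps (steps_of_step1 (step1_garside hM _ _ i' a (!b))) (by simp)
      have : u ++ [(b, i')] ++ salt i' (!b) M ++ v =
          u ++ salt i' b M ++ ((altAt b M, i') :: v) := by
        have := salt_garside_comm i' b M
        simp only [append_assoc, singleton_append, ← this]
      rw [this] at h'
      rw [constSign_append]
      exact ⟨ih (h'.of_steps (steps_of_step1 (step1_garside hM _ _ i' _ a)) (by simp)),
        by simp [ConstSign]⟩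
    · obtain rfl : i' = !i := by cases i <;> cases i' <;> simp_all
      have h' := h.of_steps (steps_of_step1 (step1_garside hM _ _ i a b)) (by simp)
      obtain ⟨c, rfl⟩ : ∃ c, M = c + 1 := ⟨M - 1, by lia⟩
      rw [salt_succ] at h'
      refine (Stuck.not_cancel (A := dih (c + 1) hM) (w₁ := u) (a := (b, !i))
        (w₂ := salt i (!b) c ++ v) ?_).elim
      simpa [letterInv] using h'

lemma Stuck.constSign_or_bword {w : Word Bool} (h : Stuck (dih M hM) w) :
    (∃ i, ConstSign i w) ∨ ∃ e L, BValid M L ∧ w = bword M e L := by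
  rcases exists_bword hM w with ⟨u, v, i, a, rfl⟩ | ⟨u, x, v, rfl⟩ | hb
  · refine .inl ⟨i, ?_⟩
    rw [constSign_append, constSign_append]
    exact ⟨⟨h.constSign_left hM, constSign_salt i a M⟩, h.constSign_right hM⟩
  · exact h.not_cancel.elim
  · exact .inr hb

/-- The parameter for which the potential is, up to sign, the exponent sum. -/
def signTheta (M : ℕ) (i : Bool) : ℤ := cond i M 0

lemma signTheta_mem (M : ℕ) (i : Bool) : 0 ≤ signTheta M i ∧ signTheta M i ≤ M := by
  cases i <;> simp [signTheta]

include hM in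
lemma pot_act_sign (i : Bool) {q : DState} (hq : q.Valid M) (x : Bool × Bool) :
    pot M (signTheta M i) (act M x q) =
      pot M (signTheta M i) q + if x.2 = i then 1 else -1 := by
  have h1 : ((M - 1 : ℕ) : ℤ) = M - 1 := by push_cast [show 1 ≤ M by lia]; ring
  have h2 : (2 * M - M : ℤ) = M := by ring
  obtain ⟨a, s⟩ := x
  cases q with
  | emp r =>
    cases i <;> cases s <;> simp [act, pot, signTheta, h1, h2, mul_sub] <;> omega
  | ne j l e r =>
    have hj : 1 ≤ j ∧ j < M := hq j (by simp)
    cases i <;> cases s <;> simp only [act] <;> split_ifs <;>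
      simp [pot, signTheta, h1, h2, mul_sub, mul_add] <;> (try simp_all) <;> omega

include hM in
lemma pot_sign_eq_iff (i : Bool) (w : Word Bool) :
    pot M (signTheta M i) (run M w (emp 0)) = w.length ↔ ConstSign i w := by
  induction w with
  | nil => simp [pot, ConstSign]
  | cons x w ih =>
    have hle := pot_run_le hM (signTheta_mem M i).1 (signTheta_mem M i).2 w
    have : ConstSign i (x :: w) ↔ x.2 = i ∧ ConstSign i w := by simp [ConstSign]
    rw [this, ← ih, run_cons, pot_act_sign hM i (valid_run_emp hM w 0), length_cons]
    push_cast
    split_ifs with hx <;> simp only [hx, true_and, false_and, iff_false] <;> omega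

lemma Stuck.exists_pot {w : Word Bool} (h : Stuck (dih M hM) w) :
    ∃ θ : ℤ, 0 ≤ θ ∧ θ ≤ M ∧ pot M θ (run M w (emp 0)) = w.length := by
  rcases h.constSign_or_bword hM with ⟨i, hi⟩ | ⟨e, L, hL, rfl⟩
  · exact ⟨_, (signTheta_mem M i).1, (signTheta_mem M i).2, (pot_sign_eq_iff hM i w).2 hi⟩
  · exact pot_of_stuck_bword hM hL h

lemma Stuck.geodesic_dih {w : Word Bool} (h : Stuck (dih M hM) w) : Geodesic (dih M hM) w := by
  obtain ⟨θ, h0, h1, hp⟩ := h.exists_pot hM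
  exact geodesic_of_pot hM h0 h1 hp

lemma Step1.symm {A : ArtinData S} {x y : Word S} (h : Step1 A x y) : Step1 A y x := by
  obtain ⟨w₁, w₂, u, v, hr, h⟩ := h
  exact ⟨w₁, w₂, v, u, hr.symm, h.imp And.symm And.symm⟩

lemma Step1.append {A : ArtinData S} {x y : Word S} (h : Step1 A x y) (z : Word S) :
    Step1 A (x ++ z) (y ++ z) := by
  obtain ⟨w₁, w₂, u, v, hr, ⟨rfl, rfl⟩ | ⟨rfl, rfl⟩⟩ := h
  · exact ⟨w₁, w₂ ++ z, u, v, hr, .inl ⟨by simp, by simp⟩⟩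
  · exact ⟨w₁, w₂ ++ z, u, v, hr, .inr ⟨by simp, by simp⟩⟩

lemma step1_garside_right (i : Bool) {u v : Word Bool} (hv : ConstSign i v) (a : Bool) :
    ∃ v', ConstSign i v' ∧ v'.length = v.length ∧ ∀ a', Relation.ReflTransGen (Step1 (dih M hM))
      (u ++ salt i a M ++ v) (u ++ v' ++ salt i a' M) := by
  induction v generalizing u a with
  | nil =>
    refine ⟨[], hv, rfl, fun a' => ?_⟩
    simpa using step1_garside hM u [] i a a'
  | cons x v ih =>
    obtain ⟨b, i'⟩ := x
    obtain rfl : i' = i := hv _ mem_cons_self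
    have hv' : ConstSign i' v := fun l hl => hv l (mem_cons_of_mem _ hl)
    obtain ⟨v', hc, hlen, hs⟩ := ih (u := u ++ [(altAt b M, i')]) hv' (!altAt b M)
    refine ⟨(altAt b M, i') :: v', ?_, by simp [hlen], fun a' => ?_⟩
    · rintro l hl
      rcases mem_cons.1 hl with rfl | hl
      exacts [rfl, hc l hl]
    have h1 := step1_garside hM u ((b, i') :: v) i' a (altAt b M)
    have : u ++ salt i' (altAt b M) M ++ (b, i') :: v =
        (u ++ [(altAt b M, i')]) ++ salt i' (!altAt b M) M ++ v := by
      have := salt_garside_comm i' (altAt b M) M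
      rw [altAt_altAt] at this
      simp only [append_assoc, singleton_append, ← this]
    rw [this] at h1
    have h2 := hs a'
    simpa using h1.trans h2

/-- The power of the Garside word of sign `i`. -/
def garsidePow (M : ℕ) (i : Bool) (k : ℕ) : Word Bool := (replicate k (salt i true M)).flatten

lemma garsidePow_succ (M : ℕ) (i : Bool) (k : ℕ) :
    garsidePow M i (k + 1) = garsidePow M i k ++ salt i true M := by
  simp [garsidePow, replicate_succ']

lemma exists_bword_garsidePow (i : Bool) {w : Word Bool} (hw : ConstSign i w) :
    ∃ e L k, BValid M L ∧ ConstSign i (bword M e L) ∧ Relation.ReflTransGen (Step1 (dih M hM)) w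
      (bword M e L ++ garsidePow M i k) := by
  induction hn : w.length using Nat.strong_induction_on generalizing w with
  | _ n ih =>
    rcases exists_bword hM w with ⟨u, v, i', a, rfl⟩ | ⟨u, x, v, rfl⟩ | ⟨e, L, hL, rfl⟩
    · rw [constSign_append, constSign_append] at hw
      obtain rfl : i' = i := by
        refine hw.1.2 (a, i') (mem_of_mem_head? ?_)
        rw [salt_head? _ _ (by lia)]; rfl
      obtain ⟨v', hc, hlen, hs⟩ := step1_garside_right hM i' (u := u) hw.2 a
      obtain ⟨e, L, k, hL, hL', h⟩ := ih (u ++ v').length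
        (by simp [← hn, hlen]; lia) (constSign_append.2 ⟨hw.1.1, hc⟩) rfl
      refine ⟨e, L, k + 1, hL, hL', (hs true).trans ?_⟩
      rw [garsidePow_succ, ← append_assoc]
      exact h.lift (· ++ salt i' true M) fun _ _ h => h.append _
    · have h1 := hw x (by simp)
      have h2 := hw (letterInv x) (by simp)
      simp [letterInv, h1] at h2
    · exact ⟨e, L, 0, hL, hw, by simpa [garsidePow] using .refl⟩

lemma constSign_snd {i e : Bool} {L} (hL : BValid M L) (h : ConstSign i (bword M e L)) :
    ∀ b ∈ L, b.2 = i := by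
  induction L generalizing e with
  | nil => simp
  | cons b L ih =>
    obtain ⟨j, i'⟩ := b
    obtain ⟨hj, hL'⟩ := bvalid_cons.1 hL
    simp only at hj
    have key : ∀ e c, c ≠ 0 → ConstSign i (salt i' e c) → i' = i := fun e c hc hs =>
      hs (e, i') (mem_of_mem_head? (by rw [salt_head? _ _ hc]; rfl))
    cases i'
    · rw [bword_cons_false, constSign_append] at h
      have := key _ _ (by lia) h.1
      simpa [this] using ih hL' h.2
    · rw [bword_cons_true, constSign_append] at h
      have := key _ _ (by lia) h.1
      simpa [this] using ih hL' h.2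

include hM in
lemma run_garsidePow (i : Bool) (k : ℕ) (r : ℤ) :
    run M (garsidePow M i k) (emp r) = emp (r + cond i (k : ℤ) (-k)) := by
  induction k generalizing r with
  | zero => simp [garsidePow]
  | succ k ih =>
    rw [garsidePow_succ, run_append]
    cases i
    · have : run M (salt false true M) (emp r) = emp (r - 1) := by
        obtain ⟨c, rfl⟩ : ∃ c, M = c + 1 + 1 := ⟨M - 2, by lia⟩
        have h2 : c + 1 + 1 - (c + 1) = 1 := by lia
        rw [salt_succ, run_cons, Bool.not_true]
        have h4 := run_salt_false_push (M := c + 1 + 1) true [] r (c := c) (by lia)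
        rw [pop_nil, h2, Bool.not_true] at h4
        rw [h4]
        simp [act]
      rw [this, ih]
      simp
      ring
    · have h1 := run_salt_push_full hM true [] r
      rw [pop_nil, pop_nil] at h1
      rw [h1, ih]
      simp
      ring

/-- Geodesic dihedral words representing the same element are connected by transformations. -/
lemma steps_of_geodesic_dih {x y : Word Bool} (hx : Geodesic (dih M hM) x)
    (h : wbar (dih M hM) x = wbar (dih M hM) y) (hlen : x.length = y.length) :
    Steps012Star (dih M hM) x y := by
  have hy : Geodesic (dih M hM) y := fun w hw => hlen ▸ hx w (hw.trans h.symm)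
  have hrun := run_eq_of_wbar_eq hM h (q := emp 0) (by simp [Valid])
  have hsign (i : Bool) : ConstSign i x ↔ ConstSign i y := by
    rw [← pot_sign_eq_iff hM, ← pot_sign_eq_iff hM, hrun, hlen]
  by_cases hc : ∃ i, ConstSign i x
  · obtain ⟨i, hi⟩ := hc
    obtain ⟨e, L, k, hL, hLs, hs⟩ := exists_bword_garsidePow hM i hi
    obtain ⟨e', L', k', hL', hLs', hs'⟩ := exists_bword_garsidePow hM i ((hsign i).1 hi)
    have e1 := run_eq_of_wbar_eq hM (wbar_steps (steps_of_step1 hs)) (q := emp 0) (by simp [Valid])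
    have e2 := run_eq_of_wbar_eq hM (wbar_steps (steps_of_step1 hs')) (q := emp 0)
      (by simp [Valid])
    rw [← hrun, e1, run_append, run_append, run_garsidePow hM, run_garsidePow hM,
      run_bword _ hL, run_bword _ hL'] at e2
    have hfst := congrArg entries e2
    have hexp := congrArg exp e2
    simp only [entries_pop, exp_pop] at hfst hexp
    have hll : L.length = L'.length := by simpa using congrArg length hfst
    have rep {L : List (ℕ × Bool)} (hL : ∀ b ∈ L, b.2 = i) :
        L.map Prod.snd = replicate L.length i := by
      refine eq_replicate_iff.2 ⟨length_map .., fun b hb => ?_⟩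
      obtain ⟨c, hc, rfl⟩ := mem_map.1 hb
      exact hL c hc
    have r1 := rep (constSign_snd hL hLs)
    have r2 := rep (constSign_snd hL' hLs')
    have hk : k = k' := by
      rw [r1, r2, hll] at hexp
      cases i <;> simp at hexp <;> omega
    have hLL : L = L' := by
      have key (L : List (ℕ × Bool)) : (L.map Prod.fst).zip (L.map Prod.snd) = L := by
        induction L <;> simp_all
      rw [← key L, ← key L', hfst, r1, r2, hll]
    subst hk hLL
    have hw : bword M e L = bword M e' L := by
      cases L with
      | nil => rfl
      | cons b L => simp only [map_cons, pop_cons, ne.injEq] at e2; rw [e2.2.2.1]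
    rw [hw] at hs
    have : Std.Symm (Step1 (dih M hM)) := ⟨fun _ _ h => h.symm⟩
    exact steps_of_step1 (hs.trans (Std.Symm.symm _ _ hs'))
  · obtain ⟨e, L, hL, rfl⟩ := ((Stuck.of_geodesic hx).constSign_or_bword hM).resolve_left hc
    obtain ⟨e', L', hL', rfl⟩ := ((Stuck.of_geodesic hy).constSign_or_bword hM).resolve_left
      (by simpa only [hsign] using hc)
    rw [run_bword _ hL, run_bword _ hL'] at hrun
    have hfst := congrArg entries hrun
    have hexp := congrArg exp hrun
    simp only [entries_pop, exp_pop] at hfst hexp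
    have hll : L.length = L'.length := by simpa using congrArg length hfst
    have hperm : (L.map Prod.snd).Perm (L'.map Prod.snd) := by
      have h1 : ∀ l : List Bool, l.count true + l.count false = l.length :=
        fun l => by induction l with
          | nil => rfl
          | cons b l ih => cases b <;> simp <;> lia
      have h2 := h1 (L.map Prod.snd)
      have h3 := h1 (L'.map Prod.snd)
      rw [length_map] at h2 h3
      rw [perm_iff_count]
      rintro (_ | _) <;> lia
    have hw : bword M e' L' = bword M e L' := by
      cases L with
      | nil => obtain rfl : L' = [] := by simpa using hfst.symm
               rfl
      | cons b L =>
        cases L' with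
        | nil => simp at hfst
        | cons b' L' => simp only [map_cons, pop_cons, ne.injEq] at hrun; rw [hrun.2.2.1]
    rw [hw]
    exact steps_bword hM hL hfst hperm e

/-- A geodesic dihedral word cannot be shortened both by a letter and by its inverse. -/
lemma not_both_shorten {d d₁ d₂ : Word Bool} {a : Bool × Bool} (hd : Geodesic (dih M hM) d)
    (h₁ : wbar (dih M hM) d = wbar (dih M hM) (a :: d₁))
    (h₂ : wbar (dih M hM) d = wbar (dih M hM) (letterInv a :: d₂))
    (hl₁ : d.length = d₁.length + 1) (hl₂ : d.length = d₂.length + 1) : False := by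
  obtain ⟨θ, h0, h1, hp⟩ := (Stuck.of_geodesic hd).exists_pot hM
  have hv : (emp 0).Valid M := by simp [Valid]
  have key {a : Bool × Bool} {d'} (h : wbar (dih M hM) d = wbar (dih M hM) (a :: d')) :
      run M d' (emp 0) = act M (letterInv a) (run M d (emp 0)) := by
    rw [run_eq_of_wbar_eq hM h hv, run_cons]
    have := act_letterInv hM (valid_run_emp hM d' 0) (letterInv a)
    rw [letterInv_letterInv] at this
    exact this.symm
  have e1 := pot_run_le hM h0 h1 d₁
  have e2 := pot_run_le hM h0 h1 d₂
  rw [key h₁] at e1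
  rw [key h₂, letterInv_letterInv] at e2
  have := pot_act_or h0 h1 hM (valid_run_emp hM d 0) a
  lia

end garside

/-! ### Words with few syllables -/

section syllables
variable {M : ℕ} (hM : 3 ≤ M)
include hM

lemma run_replicate {θ : ℤ} (h0 : 1 ≤ θ) (h1 : θ < M) (y s : Bool) (n j l r) :
    ∃ j' l' r', run M (replicate n (y, s)) (ne j l (y == s) r) = ne j' l' (y == s) r' ∧
      (j' = j ∨ j' = cond s 1 (M - 1)) ∧
      pot M θ (ne j' l' (y == s) r') = pot M θ (ne j l (y == s) r) + n := by
  have h2 : ((M - 1 : ℕ) : ℤ) = M - 1 := by push_cast [show 1 ≤ M by lia]; ring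
  induction n with
  | zero => exact ⟨j, l, r, rfl, .inl rfl, by simp⟩
  | succ n ih =>
    obtain ⟨j', l', r', he, -, hp⟩ := ih
    rw [replicate_succ, run_cons, he]
    cases s
    · refine ⟨M - 1, j' :: l', r' - 1, by cases y <;> simp [act], .inr rfl, ?_⟩
      simp only [pot, entries_ne, map_cons, sum_cons, exp_ne, h2, mul_sub] at hp ⊢
      push_cast
      omega
    · refine ⟨1, j' :: l', r', by simp [act], .inr rfl, ?_⟩
      simp only [pot, entries_ne, map_cons, sum_cons, exp_ne] at hp ⊢
      push_cast
      omega

lemma geodesic_three_syllables (x ε s t : Bool) (k i : ℕ) :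
    Geodesic (dih M hM)
      ((x, ε) :: (replicate (k + 1) (!x, s) ++ replicate (i + 1) (x, t))) := by
  have h2 : ((M - 1 : ℕ) : ℤ) = M - 1 := by push_cast [show 1 ≤ M by lia]; ring
  by_cases hall : s = ε ∧ t = ε
  · obtain ⟨rfl, rfl⟩ := hall
    refine geodesic_of_pot hM (signTheta_mem M t).1 (signTheta_mem M t).2
      ((pot_sign_eq_iff hM t _).2 ?_)
    intro l hl
    simp only [mem_cons, mem_append, mem_replicate] at hl
    rcases hl with rfl | ⟨-, rfl⟩ | ⟨-, rfl⟩ <;> rfl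
  obtain ⟨θ, hθ1, hθM, hθ2, hθ3⟩ : ∃ θ : ℤ, 1 ≤ θ ∧ θ < M ∧
      ((s = true ∧ t = true ∨ ε = true ∧ s = true ∨ ε = true ∧ t = true) → θ = 2) ∧
      (¬ (s = true ∧ t = true ∨ ε = true ∧ s = true ∨ ε = true ∧ t = true) → θ = 1) := by
    by_cases h : s = true ∧ t = true ∨ ε = true ∧ s = true ∨ ε = true ∧ t = true
    · exact ⟨2, by lia, by lia, fun _ => rfl, fun h' => absurd h h'⟩
    · exact ⟨1, by lia, by lia, fun h' => absurd h' h, fun _ => rfl⟩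
  refine geodesic_of_pot hM (θ := θ) (by lia) hθM.le ?_
  rw [run_cons, run_append]
  obtain ⟨j, l, r, he, hj, hp⟩ : ∃ j l r, run M (replicate (i + 1) (x, t)) (emp 0) =
      ne j l (x == t) r ∧ j = cond t 1 (M - 1) ∧ pot M θ (ne j l (x == t) r) = i + 1 := by
    obtain ⟨j', l', r', he, hj, hp⟩ := run_replicate hM hθ1 hθM x t i (cond t 1 (M - 1)) []
      (cond t 0 (-1))
    refine ⟨j', l', r', ?_, hj.elim id id, ?_⟩
    · rw [replicate_succ', run_append, ← he]
      cases t <;> cases x <;> simp [act]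
    · rw [hp]
      cases t <;> simp [pot, h2] <;> omega
  obtain ⟨j', l', r', he', hj', hp'⟩ : ∃ j' l' r',
      run M (replicate (k + 1) (!x, s)) (ne j l (x == t) r) =
      ne j' l' ((!x) == s) r' ∧ (j' = cond s 1 (M - 1) ∨ j' = cond s 2 (M - 2) ∧ s = t) ∧
      pot M θ (ne j' l' ((!x) == s) r') = i + 1 + (k + 1) := by
    have key : ∃ j' l' r', act M (!x, s) (ne j l (x == t) r) = ne j' l' ((!x) == s) r' ∧
        (j' = cond s 1 (M - 1) ∨ j' = cond s 2 (M - 2) ∧ s = t) ∧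
        pot M θ (ne j' l' ((!x) == s) r') = i + 1 + 1 := by
      have h3 : M - 1 ≠ 1 := by lia
      have h4 : M - 1 - 1 = M - 2 := by lia
      have h5 : 2 ≠ M := by lia
      have h6 : ((M - 2 : ℕ) : ℤ) = M - 2 := by push_cast [show 2 ≤ M by lia]; ring
      subst hj
      cases s <;> cases t
      · refine ⟨M - 2, l, r, by cases x <;> simp [act, h3, h4], by simp, ?_⟩
        simp only [pot, entries_ne, map_cons, sum_cons, exp_ne, h2, h6, cond_false] at hp ⊢
        have := hθ3 (by simp)
        omega
      · refine ⟨M - 1, 1 :: l, r - 1, by cases x <;> simp [act], by simp, ?_⟩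
        simp only [pot, entries_ne, map_cons, sum_cons, exp_ne, h2, cond_true, mul_sub] at hp ⊢
        omega
      · refine ⟨1, (M - 1) :: l, r, by cases x <;> simp [act], by simp, ?_⟩
        simp only [pot, entries_ne, map_cons, sum_cons, exp_ne, h2, cond_false] at hp ⊢
        omega
      · refine ⟨2, l, r, by cases x <;> simp [act, h5], by simp, ?_⟩
        simp only [pot, entries_ne, map_cons, sum_cons, exp_ne, cond_true] at hp ⊢
        have := hθ2 (by simp)
        push_cast at hp ⊢
        omega
    obtain ⟨j₁, l₁, r₁, he₁, hj₁, hp₁⟩ := key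
    obtain ⟨j', l', r', he', hj', hp'⟩ := run_replicate hM hθ1 hθM (!x) s k j₁ l₁ r₁
    refine ⟨j', l', r', ?_, ?_, ?_⟩
    · rw [replicate_succ', run_append, ← he', run_cons, run_nil, he₁]
    · rcases hj' with rfl | rfl
      exacts [hj₁, .inl rfl]
    · rw [hp', hp₁]; ring
  rw [he, he']
  suffices pot M θ (act M (x, ε) (ne j' l' ((!x) == s) r')) = i + 1 + (k + 1) + 1 by
    rw [this]; simp; ring
  have h6 : ((M - 2 : ℕ) : ℤ) = M - 2 := by push_cast [show 2 ≤ M by lia]; ring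
  rw [← hp']
  have hj1 : (j' : ℤ) = j' := rfl
  cases s <;> cases ε <;> cases t <;> simp at hall hθ2 hθ3 hj' <;>
    simp only [act] <;> cases x <;> simp only [Bool.not_false, Bool.not_true, beq_self_eq_true,
      beq_true, beq_false, reduceIte, reduceCtorEq] <;>
      (try split_ifs) <;>
      simp only [pot, entries_ne, map_cons, sum_cons, exp_ne, h2, mul_sub, mul_add, entries_pop,
        exp_pop] <;> push_cast <;> omega

omit hM in
lemma Geodesic.of_append_left {A : ArtinData S} {x y : Word S} (h : Geodesic A (x ++ y)) :
    Geodesic A x := by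
  intro w hw
  have := h (w ++ y) (by rw [wbar_append, wbar_append, hw])
  simpa using this

omit hM in
lemma Geodesic.of_append_right {A : ArtinData S} {x y : Word S} (h : Geodesic A (x ++ y)) :
    Geodesic A y := by
  intro w hw
  have := h (x ++ w) (by rw [wbar_append, wbar_append, hw])
  simpa using this

omit hM in
lemma eq_replicate_of_geodesic {A : ArtinData S} {p : Word S} {y : S} (hp : ∀ l ∈ p, l.1 = y)
    (h : Geodesic A p) : ∃ s, p = replicate p.length (y, s) := by
  induction p with
  | nil => exact ⟨true, rfl⟩
  | cons a p ih =>
    obtain ⟨s, hs⟩ := ih (fun l hl => hp l (mem_cons_of_mem _ hl))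
      (Geodesic.of_append_right (x := [a]) h)
    have ha : a.1 = y := hp a mem_cons_self
    obtain ⟨b, i⟩ := a
    obtain rfl : b = y := ha
    cases p with
    | nil => exact ⟨i, rfl⟩
    | cons c p =>
      obtain rfl : c = (b, s) := by simpa [replicate_succ] using congrArg head? hs
      by_cases hi : i = s
      · subst hi
        refine ⟨i, ?_⟩
        rw [length_cons, replicate_succ, ← hs]
      · obtain rfl : s = !i := by clear * - hi; cases i <;> cases s <;> simp at hi ⊢
        have := h p (wbar_cons_cons_cancel (b, i) p).symm
        simp at this

/-- A geodesic dihedral word of the form `y^k x^i` does not have geodesic representatives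
beginning with both generators. -/
lemma two_syllables_head {p q d d' : Word Bool} {a b : Bool × Bool} {x : Bool}
    (hp : ∀ l ∈ p, l.1 = !x) (hq : ∀ l ∈ q, l.1 = x) (hg : Geodesic (dih M hM) (p ++ q))
    (ha : a.1 = x) (hb : b.1 = !x)
    (h : wbar (dih M hM) (p ++ q) = wbar (dih M hM) (a :: d))
    (hl : (p ++ q).length = (a :: d).length)
    (h' : wbar (dih M hM) (p ++ q) = wbar (dih M hM) (b :: d'))
    (hl' : (p ++ q).length = (b :: d').length) : False := by
  obtain ⟨s, hs⟩ := eq_replicate_of_geodesic hp hg.of_append_left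
  obtain ⟨t, ht⟩ := eq_replicate_of_geodesic hq hg.of_append_right
  have key {c : Bool × Bool} {e : Word Bool}
      (h : wbar (dih M hM) (p ++ q) = wbar (dih M hM) (c :: e))
      (hl : (p ++ q).length = (c :: e).length)
      (hc : Geodesic (dih M hM) (letterInv c :: (p ++ q))) : False := by
    have := hc e (by
      rw [wbar_cons _ (letterInv c), h, wbar_cons _ c, wbar_letterInv]; group)
    simp only [length_cons] at this hl
    lia
  obtain ⟨ax, ai⟩ := a
  obtain ⟨bx, bi⟩ := b
  simp only at ha hb
  subst ha hb
  rcases hk : p.length with _ | k <;> rcases hi : q.length with _ | i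
  · simp [hk, hi] at hl
  · refine key h' hl' ?_
    have := geodesic_three_syllables hM ax true (!bi) t 0 i
    rw [length_eq_zero_iff.1 hk, nil_append, ht, hi]
    exact Geodesic.of_append_right (x := [(ax, true)]) this
  · refine key h hl ?_
    have := geodesic_three_syllables hM ax (!ai) s true k 0
    rw [length_eq_zero_iff.1 hi, append_nil, hs, hk]
    exact Geodesic.of_append_left (y := [(ax, true)]) this
  · refine key h hl ?_
    have := geodesic_three_syllables hM ax (!ai) s t k i
    rw [ht, hs, hi, hk]
    exact this

end syllables

/-! ### Words over a pair of generators -/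

section pair
variable {A : ArtinData S} {s t : S}

lemma wbar_emb {M : ℕ} {hM : 3 ≤ M} (hst : s ≠ t) (hm : A.m s t = M) {x y : Word Bool}
    (h : wbar (dih M hM) x = wbar (dih M hM) y) : wbar A (emb s t x) = wbar A (emb s t y) := by
  have hev (w : Word Bool) :
      evalWord (fun b => wbar A [(cond b s t, true)]) w = wbar A (emb s t w) := by
    induction w with
    | nil => rfl
    | cons a w ih =>
      rw [evalWord_cons, ih, emb_cons, wbar_cons _ (embLetter s t a)]
      obtain ⟨b, _ | _⟩ := a
      · rw [show embLetter s t (b, false) = letterInv (cond b s t, true) from rfl, wbar_letterInv]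
        rfl
      · rfl
  obtain ⟨φ, hφ⟩ := exists_hom (A := dih M hM) (fun b => wbar A [(cond b s t, true)]) (by
    intro a b k hab hk
    rw [hev, hev]
    exact wbar_eq_of_isRel (IsRel.emb hst hm ⟨a, b, k, hab, hk, rfl, rfl⟩))
  rw [← hev, ← hev, ← hφ, ← hφ, h]

lemma emb_swap (x : Word Bool) : emb t s (emb false true x) = emb s t x := by
  simp only [emb, map_map]
  refine map_congr_left fun a _ => ?_
  obtain ⟨_ | _, i⟩ := a <;> rfl

lemma emb_swap_swap (x : Word Bool) : emb false true (emb false true x) = x := by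
  rw [emb_swap]
  simp only [emb]
  refine (map_congr_left fun a _ => ?_).trans (map_id x)
  obtain ⟨_ | _, i⟩ := a <;> rfl

lemma wbar_swap {M : ℕ} {hM : 3 ≤ M} {x y : Word Bool}
    (h : wbar (dih M hM) x = wbar (dih M hM) y) :
    wbar (dih M hM) (emb false true x) = wbar (dih M hM) (emb false true y) :=
  wbar_emb (by simp) rfl h

/-- The words `d` and `d'` over `{s,t}` represent the same element of the dihedral
Artin-Tits group on `{s,t}`. -/
def PairEq (A : ArtinData S) (s t : S) (d d' : Word S) : Prop :=
  s ≠ t ∧ ∃ (k : ℕ) (hk : 3 ≤ k) (x y : Word Bool), A.m s t = k ∧ emb s t x = d ∧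
    emb s t y = d' ∧ wbar (dih k hk) x = wbar (dih k hk) y

/-- The word `d` over `{s,t}` is geodesic in the dihedral Artin-Tits group on `{s,t}`. -/
def PairGeo (A : ArtinData S) (s t : S) (d : Word S) : Prop :=
  s ≠ t ∧ ∃ (k : ℕ) (hk : 3 ≤ k) (x : Word Bool), A.m s t = k ∧ emb s t x = d ∧
    Geodesic (dih k hk) x

/-- The word `d` is over `{s,t}`. -/
def Over (s t : S) (d : Word S) : Prop := ∀ l ∈ d, l.1 = s ∨ l.1 = t

lemma over_iff {d : Word S} : Over s t d ↔ ∃ x, emb s t x = d := by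
  constructor
  · intro h
    induction d with
    | nil => exact ⟨[], rfl⟩
    | cons a d ih =>
      obtain ⟨x, rfl⟩ := ih fun l hl => h l (mem_cons_of_mem _ hl)
      obtain ⟨b, rfl⟩ := exists_embLetter (h a mem_cons_self)
      exact ⟨b :: x, rfl⟩
  · rintro ⟨x, rfl⟩ l hl
    simp only [emb, mem_map] at hl
    obtain ⟨a, -, rfl⟩ := hl
    exact embLetter_fst a

lemma emb_eq_cons {x : Word Bool} {a : S × Bool} {d : Word S} (h : emb s t x = a :: d) :
    ∃ b y, x = b :: y ∧ embLetter s t b = a ∧ emb s t y = d := by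
  cases x with
  | nil => simp at h
  | cons b y => exact ⟨b, y, rfl, by simpa using h⟩

lemma emb_eq_append {x : Word Bool} {d e : Word S} (h : emb s t x = d ++ e) :
    ∃ y z, x = y ++ z ∧ emb s t y = d ∧ emb s t z = e :=
  map_eq_append_iff.1 h

lemma Over.cons {a : S × Bool} {d : Word S} (ha : a.1 = s ∨ a.1 = t) (hd : Over s t d) :
    Over s t (a :: d) := forall_mem_cons.2 ⟨ha, hd⟩

lemma Over.append {d e : Word S} (hd : Over s t d) (he : Over s t e) : Over s t (d ++ e) :=
  forall_mem_append.2 ⟨hd, he⟩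

lemma PairEq.symm {d d' : Word S} (h : PairEq A s t d d') : PairEq A s t d' d := by
  obtain ⟨hst, k, hk, x, y, hm, rfl, rfl, h⟩ := h
  exact ⟨hst, k, hk, y, x, hm, rfl, rfl, h.symm⟩

lemma PairEq.trans {d e f : Word S} (h : PairEq A s t d e) (h' : PairEq A s t e f) :
    PairEq A s t d f := by
  obtain ⟨hst, k, hk, x, y, hm, rfl, rfl, h⟩ := h
  obtain ⟨-, k', hk', y', z, hm', he, rfl, h'⟩ := h'
  obtain rfl : k = k' := by exact_mod_cast hm.symm.trans hm'
  obtain rfl := emb_injective hst he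
  exact ⟨hst, k, hk, x, z, hm, rfl, rfl, h.trans h'⟩

lemma PairEq.ne {d d' : Word S} (h : PairEq A s t d d') : s ≠ t := h.1

lemma PairEq.over {d d' : Word S} (h : PairEq A s t d d') : Over s t d := by
  obtain ⟨-, k, hk, x, y, -, rfl, -⟩ := h
  exact over_iff.2 ⟨x, rfl⟩

lemma PairEq.swap {d d' : Word S} (h : PairEq A s t d d') : PairEq A t s d d' := by
  obtain ⟨hst, k, hk, x, y, hm, rfl, rfl, h⟩ := h
  exact ⟨hst.symm, k, hk, _, _, by rw [A.symm, hm], emb_swap x, emb_swap y, wbar_swap h⟩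

lemma PairEq.append_right {d d' e : Word S} (h : PairEq A s t d d') (he : Over s t e) :
    PairEq A s t (d ++ e) (d' ++ e) := by
  obtain ⟨hst, k, hk, x, y, hm, rfl, rfl, h⟩ := h
  obtain ⟨z, rfl⟩ := over_iff.1 he
  exact ⟨hst, k, hk, x ++ z, y ++ z, hm, emb_append .., emb_append .., by
    rw [wbar_append, wbar_append, h]⟩

lemma PairEq.append_left {d d' e : Word S} (h : PairEq A s t d d') (he : Over s t e) :
    PairEq A s t (e ++ d) (e ++ d') := by
  obtain ⟨hst, k, hk, x, y, hm, rfl, rfl, h⟩ := h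
  obtain ⟨z, rfl⟩ := over_iff.1 he
  exact ⟨hst, k, hk, z ++ x, z ++ y, hm, emb_append .., emb_append .., by
    rw [wbar_append, wbar_append, h]⟩

lemma PairEq.cons {a : S × Bool} {d d' : Word S} (h : PairEq A s t d d')
    (ha : a.1 = s ∨ a.1 = t) : PairEq A s t (a :: d) (a :: d') :=
  h.append_left (e := [a]) (by simpa [Over] using ha)

lemma PairEq.of_cons {a : S × Bool} {d d' : Word S} (h : PairEq A s t (a :: d) (a :: d')) :
    PairEq A s t d d' := by
  obtain ⟨hst, k, hk, x, y, hm, hx, hy, h⟩ := h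
  obtain ⟨b, x, rfl, rfl, rfl⟩ := emb_eq_cons hx
  obtain ⟨b', y, rfl, hb, rfl⟩ := emb_eq_cons hy
  obtain rfl := embLetter_injective hst hb
  exact ⟨hst, k, hk, x, y, hm, rfl, rfl, by
    rw [wbar_cons, wbar_cons _ b' y] at h
    exact mul_left_cancel h⟩

lemma PairEq.cons_letterInv {a : S × Bool} {d d' : Word S}
    (h : PairEq A s t d (letterInv a :: d')) : PairEq A s t (a :: d) d' := by
  obtain ⟨hst, k, hk, x, y, hm, rfl, hy, h⟩ := h
  obtain ⟨b, y, rfl, hb, rfl⟩ := emb_eq_cons hy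
  refine ⟨hst, k, hk, letterInv b :: x, y, hm, by simp [emb_letterInv, hb], rfl, ?_⟩
  rw [wbar_cons, h, wbar_cons _ b, wbar_letterInv]
  group

lemma PairGeo.ne {d : Word S} (h : PairGeo A s t d) : s ≠ t := h.1

lemma PairGeo.over {d : Word S} (h : PairGeo A s t d) : Over s t d := by
  obtain ⟨-, k, hk, x, -, rfl, -⟩ := h
  exact over_iff.2 ⟨x, rfl⟩

lemma PairGeo.swap {d : Word S} (h : PairGeo A s t d) : PairGeo A t s d := by
  obtain ⟨hst, k, hk, x, hm, rfl, h⟩ := h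
  refine ⟨hst.symm, k, hk, _, by rw [A.symm, hm], emb_swap x, fun w hw => ?_⟩
  have := wbar_swap hw
  rw [emb_swap_swap] at this
  simpa using h _ this

lemma PairGeo.refl_of_over {d e : Word S} (h : PairGeo A s t d) (he : Over s t e) :
    PairEq A s t e e := by
  obtain ⟨hst, k, hk, x, hm, rfl, h⟩ := h
  obtain ⟨y, rfl⟩ := over_iff.1 he
  exact ⟨hst, k, hk, y, y, hm, rfl, rfl, rfl⟩

lemma PairGeo.refl {d : Word S} (h : PairGeo A s t d) : PairEq A s t d d := h.refl_of_over h.over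

lemma PairGeo.of_append_left {d e : Word S} (h : PairGeo A s t (d ++ e)) : PairGeo A s t d := by
  obtain ⟨hst, k, hk, x, hm, hx, h⟩ := h
  obtain ⟨y, z, rfl, rfl, rfl⟩ := emb_eq_append hx
  exact ⟨hst, k, hk, y, hm, rfl, h.of_append_left⟩

lemma PairGeo.of_append_right {d e : Word S} (h : PairGeo A s t (d ++ e)) : PairGeo A s t e := by
  obtain ⟨hst, k, hk, x, hm, hx, h⟩ := h
  obtain ⟨y, z, rfl, rfl, rfl⟩ := emb_eq_append hx
  exact ⟨hst, k, hk, z, hm, rfl, h.of_append_right⟩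

lemma PairGeo.of_cons {a : S × Bool} {d : Word S} (h : PairGeo A s t (a :: d)) :
    PairGeo A s t d :=
  h.of_append_right (d := [a])

lemma PairGeo.nil {d : Word S} (h : PairGeo A s t d) : PairGeo A s t [] :=
  h.of_append_left (d := []) (e := d)

lemma PairGeo.length_le {d d' : Word S} (h : PairGeo A s t d) (h' : PairEq A s t d d') :
    d.length ≤ d'.length := by
  obtain ⟨hst, k, hk, x, hm, rfl, h⟩ := h
  obtain ⟨-, k', hk', y', z, hm', he, rfl, h'⟩ := h'
  obtain rfl : k = k' := by exact_mod_cast hm.symm.trans hm'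
  obtain rfl := emb_injective hst he
  simpa using h z h'.symm

lemma PairGeo.of_length_le {d d' : Word S} (h : PairGeo A s t d) (h' : PairEq A s t d d')
    (hl : d'.length ≤ d.length) : PairGeo A s t d' := by
  obtain ⟨hst, k, hk, x, hm, rfl, h⟩ := h
  obtain ⟨-, k', hk', y', z, hm', he, rfl, h'⟩ := h'
  obtain rfl : k = k' := by exact_mod_cast hm.symm.trans hm'
  obtain rfl := emb_injective hst he
  refine ⟨hst, k, hk, z, hm, rfl, fun w hw => ?_⟩
  rw [emb_length, emb_length] at hl
  exact hl.trans (h w (hw.trans h'.symm))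

lemma PairGeo.length_eq {d d' : Word S} (hd : PairGeo A s t d) (hd' : PairGeo A s t d')
    (h : PairEq A s t d d') : d.length = d'.length :=
  (hd.length_le h).antisymm (hd'.length_le h.symm)

lemma PairGeo.cons_or {a : S × Bool} {d : Word S} (h : PairGeo A s t d) (ha : a.1 = s ∨ a.1 = t) :
    PairGeo A s t (a :: d) ∨
      ∃ g, PairEq A s t d (letterInv a :: g) ∧ PairGeo A s t (letterInv a :: g) := by
  obtain ⟨hst, k, hk, x, hm, rfl, h⟩ := h
  obtain ⟨b, rfl⟩ := exists_embLetter ha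
  by_cases hg : Geodesic (dih k hk) (b :: x)
  · exact .inl ⟨hst, k, hk, b :: x, hm, rfl, hg⟩
  right
  simp only [Geodesic, not_forall, not_le] at hg
  obtain ⟨g, hg, hl⟩ := hg
  have hpar := parity_of_wbar_eq hk hg
  have he : wbar (dih k hk) x = wbar (dih k hk) (letterInv b :: g) := by
    rw [wbar_cons, hg, wbar_cons _ b, wbar_letterInv]; group
  refine ⟨emb s t g, ⟨hst, k, hk, x, letterInv b :: g, hm, rfl, rfl, he⟩,
    hst, k, hk, letterInv b :: g, hm, rfl, fun w hw => le_trans ?_ (h w (hw.trans he.symm))⟩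
  simp only [length_cons] at hl hpar ⊢
  lia

lemma PairEq.fst_ne_letterInv {a : S × Bool} {d d' : Word S}
    (h : PairEq A s t (a :: d) (letterInv a :: d')) (hd : PairGeo A s t (a :: d))
    (hd' : PairGeo A s t (letterInv a :: d')) : False := by
  have hl := hd.length_eq hd' h
  obtain ⟨hst, k, hk, x, hm, hx, hg⟩ := hd
  obtain ⟨-, k', hk', y, z, hm', hy, hz, h⟩ := h
  obtain rfl : k = k' := by exact_mod_cast hm.symm.trans hm'
  obtain rfl := emb_injective hst (hx.trans hy.symm)
  obtain ⟨b, x, rfl, rfl, rfl⟩ := emb_eq_cons hx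
  obtain ⟨c, z, rfl, hc, rfl⟩ := emb_eq_cons hz
  obtain rfl : c = letterInv b := embLetter_injective hst hc
  exact not_both_shorten hk hg rfl h (by simp) (by simpa using hl)

lemma PairGeo.two_syllables_head {p q d d' : Word S} {a b : S × Bool} (hp : ∀ l ∈ p, l.1 = t)
    (hq : ∀ l ∈ q, l.1 = s) (ha : a.1 = s) (hb : b.1 = t) (hg : PairGeo A s t (a :: d))
    (hg' : PairGeo A s t (b :: d')) (hpq : PairGeo A s t (p ++ q))
    (h : PairEq A s t (p ++ q) (a :: d)) (h' : PairEq A s t (p ++ q) (b :: d')) : False := by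
  have hl := hpq.length_eq hg h
  have hl' := hpq.length_eq hg' h'
  obtain ⟨hst, k, hk, x, hm, hx, hpq⟩ := hpq
  obtain ⟨-, k', hk', y, z, hm', hy, hz, h⟩ := h
  obtain rfl : k = k' := by exact_mod_cast hm.symm.trans hm'
  obtain rfl := emb_injective hst (hx.trans hy.symm)
  obtain ⟨-, k', hk', y, z', hm', hy, hz', h'⟩ := h'
  obtain rfl : k = k' := by exact_mod_cast hm.symm.trans hm'
  obtain rfl := emb_injective hst (hx.trans hy.symm)
  obtain ⟨p, q, rfl, rfl, rfl⟩ := emb_eq_append hx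
  obtain ⟨c, z, rfl, rfl, rfl⟩ := emb_eq_cons hz
  obtain ⟨c', z', rfl, rfl, rfl⟩ := emb_eq_cons hz'
  have key (l : Bool × Bool) : ((embLetter s t l).1 = s → l.1 = true) ∧
      ((embLetter s t l).1 = t → l.1 = false) := by
    obtain ⟨_ | _, i⟩ := l <;> simp [embLetter, hst, hst.symm]
  exact ArtinTits.two_syllables_head hk (x := true)
    (fun l hl => (key l).2 (hp _ (mem_map_of_mem hl)))
    (fun l hl => (key l).1 (hq _ (mem_map_of_mem hl))) hpq ((key c).1 ha) ((key c').2 hb) h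
    (by simpa [emb_append] using hl) h' (by simpa [emb_append] using hl')

lemma pairEq_altWord (hlarge : ∀ s t : S, s ≠ t → 3 ≤ A.m s t) (hst : s ≠ t) {k : ℕ}
    (hm : A.m s t = k) : PairEq A s t (altWord s t k) (altWord t s k) := by
  have hk : 3 ≤ k := by exact_mod_cast hm ▸ hlarge s t hst
  exact ⟨hst, k, hk, altWord true false k, altWord false true k, hm, emb_altWord .., emb_altWord ..,
    wbar_eq_of_isRel ⟨true, false, k, by simp, rfl, rfl, rfl⟩⟩

lemma pairGeo_nil (hlarge : ∀ s t : S, s ≠ t → 3 ≤ A.m s t) (hst : s ≠ t) {k : ℕ}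
    (hm : A.m s t = k) : PairGeo A s t [] :=
  ⟨hst, k, by exact_mod_cast hm ▸ hlarge s t hst, [], hm, rfl, fun _ _ => Nat.zero_le _⟩

end pair

/-! ### Equivalence of words through dihedral exchanges -/

/-- The equivalence generated by dihedral exchanges of geodesic left factors, in a form that
allows recursion on the length. -/
inductive Eqv (A : ArtinData S) : Word S → Word S → Prop
  | nil : Eqv A [] []
  | cons (a : S × Bool) {w w' : Word S} : Eqv A w w' → Eqv A (a :: w) (a :: w')
  | pair {a b : S × Bool} {d d' u w v : Word S} :
      PairEq A a.1 b.1 (a :: d) (b :: d') → PairGeo A a.1 b.1 (a :: d) →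
      PairGeo A a.1 b.1 (b :: d') → Eqv A w (d ++ u) → Eqv A v (d' ++ u) →
      Eqv A (a :: w) (b :: v)

/-- No equivalent of a right factor of the word starts with the inverse of the preceding
letter. -/
def Red (A : ArtinData S) : Word S → Prop
  | [] => True
  | a :: w => Red A w ∧ ∀ u, ¬ Eqv A w (letterInv a :: u)

/-- No word equivalent to `u` starts with a letter over `{s,t}`. -/
def MinPair (A : ArtinData S) (s t : S) (u : Word S) : Prop :=
  ∀ c u', c.1 = s ∨ c.1 = t → ¬ Eqv A u (c :: u')

section eqv
variable {A : ArtinData S} {s t : S}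

lemma PairEq.reorient {p q : S} {d d' : Word S} (h : PairEq A p q d d') (hp : p = s ∨ p = t)
    (hq : q = s ∨ q = t) : PairEq A s t d d' := by
  have := h.ne
  rcases hp with rfl | rfl <;> rcases hq with rfl | rfl
  exacts [absurd rfl this, h, h.swap, absurd rfl this]

lemma PairGeo.reorient {p q : S} {d : Word S} (h : PairGeo A p q d) (hp : p = s ∨ p = t)
    (hq : q = s ∨ q = t) : PairGeo A s t d := by
  have := h.ne
  rcases hp with rfl | rfl <;> rcases hq with rfl | rfl
  exacts [absurd rfl this, h, h.swap, absurd rfl this]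

lemma MinPair.swap {u : Word S} (h : MinPair A s t u) : MinPair A t s u :=
  fun c u' hc => h c u' hc.symm

lemma Eqv.symm {w w' : Word S} (h : Eqv A w w') : Eqv A w' w := by
  induction h with
  | nil => exact .nil
  | cons a _ ih => exact ih.cons a
  | pair h hg hg' h₁ h₂ => exact .pair h.symm.swap hg'.swap hg.swap h₂ h₁

lemma Eqv.refl : ∀ w : Word S, Eqv A w w
  | [] => .nil
  | a :: w => (Eqv.refl w).cons a

lemma Eqv.length_eq {w w' : Word S} (h : Eqv A w w') : w.length = w'.length := by
  induction h with
  | nil => rfl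
  | cons a _ ih => simp [ih]
  | pair h hg hg' _ _ ih₁ ih₂ =>
    have := hg.length_eq hg' h
    simp only [length_cons, length_append] at this ih₁ ih₂ ⊢
    lia

lemma Eqv.append_left (p : Word S) {w w' : Word S} (h : Eqv A w w') : Eqv A (p ++ w) (p ++ w') := by
  induction p with
  | nil => exact h
  | cons a p ih => exact ih.cons a

lemma eqv_cons_iff {a b : S × Bool} {w w' : Word S} :
    Eqv A (a :: w) (b :: w') ↔ a = b ∧ Eqv A w w' ∨ ∃ d d' u,
      PairEq A a.1 b.1 (a :: d) (b :: d') ∧ PairGeo A a.1 b.1 (a :: d) ∧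
      PairGeo A a.1 b.1 (b :: d') ∧ Eqv A w (d ++ u) ∧ Eqv A w' (d' ++ u) := by
  constructor
  · rintro (_ | ⟨_, h⟩ | ⟨h, hg, hg', h₁, h₂⟩)
    · exact .inl ⟨rfl, h⟩
    · exact .inr ⟨_, _, _, h, hg, hg', h₁, h₂⟩
  · rintro (⟨rfl, h⟩ | ⟨d, d', u, h, hg, hg', h₁, h₂⟩)
    · exact h.cons a
    · exact .pair h hg hg' h₁ h₂

lemma Eqv.of_cons {a : S × Bool} {w w' : Word S} (h : Eqv A (a :: w) (a :: w')) : Eqv A w w' := by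
  rcases eqv_cons_iff.1 h with ⟨-, h⟩ | ⟨_, _, _, h, -⟩
  · exact h
  · exact absurd rfl h.ne

lemma PairEq.eqv {d d' : Word S} (h : PairEq A s t d d') (hd : PairGeo A s t d)
    (hd' : PairGeo A s t d') (u : Word S) : Eqv A (d ++ u) (d' ++ u) := by
  have hl := hd.length_eq hd' h
  induction d generalizing d' with
  | nil =>
    obtain rfl : d' = [] := length_eq_zero_iff.1 hl.symm
    exact .refl _
  | cons a d ih =>
    obtain _ | ⟨b, d'⟩ := d'
    · simp at hl
    by_cases hab : a.1 = b.1
    · rcases eq_or_eq_letterInv hab with rfl | rfl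
      · exact (ih h.of_cons hd.of_cons hd'.of_cons (by simpa using hl)).cons b
      · exact (h.fst_ne_letterInv hd hd').elim
    · have ha := hd.over a mem_cons_self
      have hb := hd'.over b mem_cons_self
      have hs : s = a.1 ∨ s = b.1 := by
        rcases ha with ha | ha <;> rcases hb with hb | hb <;> simp_all
      have ht : t = a.1 ∨ t = b.1 := by
        rcases ha with ha | ha <;> rcases hb with hb | hb <;> simp_all
      exact .pair (h.reorient hs ht) (hd.reorient hs ht) (hd'.reorient hs ht) (.refl _) (.refl _)

lemma Red.of_append {p x : Word S} (h : Red A (p ++ x)) : Red A x := by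
  induction p with
  | nil => exact h
  | cons a p ih => exact ih h.1

lemma Red.pairGeo (hn : PairGeo A s t []) {x u : Word S} (hx : Over s t x)
    (h : Red A (x ++ u)) : PairGeo A s t x := by
  induction x with
  | nil => exact hn
  | cons a x ih =>
    have hg := ih (fun l hl => hx l (mem_cons_of_mem _ hl)) h.1
    rcases hg.cons_or (hx a mem_cons_self) with h' | ⟨g, hg₁, hg₂⟩
    · exact h'
    · exact (h.2 _ (hg₁.eqv hg hg₂ u)).elim

/-- On reduced words of length at most `n`, equivalence is transitive and preserves
reducedness. -/
def TransUpTo (A : ArtinData S) (n : ℕ) : Prop :=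
  ∀ x y z, x.length ≤ n → Red A x → Eqv A x y → Eqv A y z → Red A y ∧ Eqv A x z

section level
variable {n : ℕ} (H : TransUpTo A n)
include H

lemma TransUpTo.red {x y : Word S} (hl : x.length ≤ n) (hx : Red A x) (h : Eqv A x y) :
    Red A y := (H x y y hl hx h (.refl y)).1

lemma TransUpTo.trans {x y z : Word S} (hl : x.length ≤ n) (hx : Red A x) (h : Eqv A x y)
    (h' : Eqv A y z) : Eqv A x z := (H x y z hl hx h h').2

lemma TransUpTo.red_cons {a : S × Bool} {w w' : Word S} (hl : w.length ≤ n)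
    (hw : Red A (a :: w)) (h : Eqv A w w') : Red A (a :: w') :=
  ⟨H.red hl hw.1 h, fun u hu => hw.2 u (H.trans hl hw.1 h hu)⟩

lemma TransUpTo.strip (P : S → Prop) {x : Word S} (hl : x.length ≤ n) (hx : Red A x) :
    ∃ f u, (∀ l ∈ f, P l.1) ∧ (∀ c u', P c.1 → ¬ Eqv A u (c :: u')) ∧ Eqv A x (f ++ u) ∧
      Red A (f ++ u) := by
  have key : ∀ m (f u : Word S), u.length = m → (∀ l ∈ f, P l.1) → (f ++ u).length ≤ n →
      Red A (f ++ u) → ∃ f' u', (∀ l ∈ f', P l.1) ∧ (∀ c u'', P c.1 → ¬ Eqv A u' (c :: u'')) ∧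
        Eqv A (f ++ u) (f' ++ u') ∧ Red A (f' ++ u') := by
    intro m
    induction m with
    | zero =>
      intro f u hu hf hl hr
      obtain rfl := length_eq_zero_iff.1 hu
      exact ⟨f, [], hf, fun c u' _ h => by simpa using h.length_eq, .refl _, hr⟩
    | succ m ih =>
      intro f u hu hf hl hr
      by_cases hm : ∀ c u', P c.1 → ¬ Eqv A u (c :: u')
      · exact ⟨f, u, hf, hm, .refl _, hr⟩
      simp only [not_forall, not_not] at hm
      obtain ⟨c, u₁, hc, he⟩ := hm
      have he' := he.append_left f
      have hr' := H.red hl hr he'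
      rw [append_cons] at hr' he'
      obtain ⟨f', u', hf', hu', h₁, h₂⟩ := ih (f ++ [c]) u₁ (by simpa [hu] using he.length_eq.symm)
        (forall_mem_append.2 ⟨hf, by simpa using hc⟩) (he'.length_eq ▸ hl) hr'
      exact ⟨f', u', hf', hu', H.trans hl hr he' h₁, h₂⟩
  exact key _ [] x rfl (by simp) hl hx

lemma TransUpTo.decomp (hn : PairGeo A s t []) {x : Word S} (hl : x.length ≤ n)
    (hx : Red A x) : ∃ f u, PairGeo A s t f ∧ MinPair A s t u ∧ Eqv A x (f ++ u) ∧
      Red A (f ++ u) := by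
  obtain ⟨f, u, hf, hu, h, hr⟩ := H.strip (fun p => p = s ∨ p = t) hl hx
  exact ⟨f, u, hr.pairGeo hn hf, hu, h, hr⟩

lemma TransUpTo.decomp_unique {d u e u' : Word S} (hl : (d ++ u).length ≤ n)
    (hr : Red A (d ++ u)) (hd : PairGeo A s t d) (he : PairGeo A s t e)
    (hu : MinPair A s t u) (hu' : MinPair A s t u') (h : Eqv A (d ++ u) (e ++ u')) :
    Eqv A u u' ∧ PairEq A s t d e := by
  obtain ⟨m, hm⟩ : ∃ m, (d ++ u).length = m := ⟨_, rfl⟩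
  induction m generalizing d u e u' with
  | zero =>
    have hl' := h.length_eq
    simp only [length_append] at hm hl'
    obtain rfl : d = [] := length_eq_zero_iff.1 (by lia)
    obtain rfl : e = [] := length_eq_zero_iff.1 (by lia)
    exact ⟨h, hd.refl⟩
  | succ m ih =>
    obtain _ | ⟨a, d⟩ := d
    · obtain _ | ⟨c, e⟩ := e
      · exact ⟨h, hd.refl⟩
      · exact (hu _ _ (he.over c mem_cons_self) h).elim
    obtain _ | ⟨c, e⟩ := e
    · exact (hu' _ _ (hd.over a mem_cons_self) h.symm).elim
    have hr₁ : Red A (d ++ u) := hr.1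
    have hr₂ : Red A (e ++ u') := (H.red hl hr h).1
    have hlen := h.length_eq
    simp only [cons_append, length_cons] at hl hm hlen
    have ha := hd.over a mem_cons_self
    have hc := he.over c mem_cons_self
    rcases eqv_cons_iff.1 h with ⟨rfl, h₀⟩ | ⟨p, p', v, hp, hg, hg', h₁, h₂⟩
    · obtain ⟨h₁, h₂⟩ := ih (by lia) hr₁ hd.of_cons he.of_cons hu hu' h₀ (by lia)
      exact ⟨h₁, h₂.cons ha⟩
    change Eqv A (d ++ u) _ at h₁
    change Eqv A (e ++ u') _ at h₂
    replace hp := hp.reorient ha hc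
    replace hg := hg.reorient ha hc
    replace hg' := hg'.reorient ha hc
    have hr₃ := H.red (by lia) hr₁ h₁
    have hr₄ := H.red (by lia) hr₂ h₂
    have hl₁ := h₁.length_eq
    have hl₂ := h₂.length_eq
    have hl₃ : v.length ≤ (p ++ v).length := by simp
    obtain ⟨q, v₀, hq, hv₀, hv, -⟩ := H.decomp hd.nil (by lia) hr₃.of_append
    have h₃ := hv.append_left p
    have h₄ := hv.append_left p'
    have hr₅ := H.red (by lia) hr₃ h₃
    have hr₆ := H.red (by lia) hr₄ h₄
    replace h₁ := H.trans (by lia) hr₁ h₁ h₃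
    replace h₂ := H.trans (by lia) hr₂ h₂ h₄
    rw [← append_assoc] at h₁ h₂ hr₅ hr₆
    have hpq := hr₅.pairGeo hd.nil (hg.of_cons.over.append hq.over)
    have hpq' := hr₆.pairGeo hd.nil (hg'.of_cons.over.append hq.over)
    obtain ⟨e₁, e₂⟩ := ih (by lia) hr₁ hd.of_cons hpq hu hv₀ h₁ (by lia)
    obtain ⟨e₃, e₄⟩ := ih (by lia) hr₂ he.of_cons hpq' hu' hv₀ h₂ (by lia)
    refine ⟨H.trans ?_ hr₁.of_append e₁ e₃.symm,
      (e₂.cons ha).trans ((hp.append_right hq.over).trans (e₄.cons hc).symm)⟩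
    simp only [length_append] at hl
    lia

lemma TransUpTo.red_append {d u : Word S} (hd : PairGeo A s t d) (hu : MinPair A s t u)
    (hr : Red A u) (hl : (d ++ u).length ≤ n + 1) : Red A (d ++ u) := by
  induction d with
  | nil => exact hr
  | cons a d ih =>
    simp only [cons_append, length_cons] at hl
    have hr₁ := ih hd.of_cons (by lia)
    refine ⟨hr₁, fun v hv => ?_⟩
    change Eqv A (d ++ u) _ at hv
    have hr₂ := H.red (by lia) hr₁ hv
    have hl₁ := hv.length_eq
    simp only [length_cons] at hl₁
    obtain ⟨f, v₀, hf, hv₀, h₁, h₂⟩ := H.decomp hd.nil (by lia) hr₂.1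
    have h₃ := H.trans (by lia) hr₁ hv (h₁.cons (letterInv a))
    have hr₃ : Red A ((letterInv a :: f) ++ v₀) := H.red (by lia) hr₁ h₃
    have hg := hr₃.pairGeo (x := letterInv a :: f) hd.nil
      (hf.over.cons (hd.over a mem_cons_self))
    have h₄ := (H.decomp_unique (d := d) (e := letterInv a :: f) (by lia) hr₁ hd.of_cons hg hu hv₀
      h₃).2
    have hl₂ := hd.length_le h₄.cons_letterInv
    have hl₃ := hd.of_cons.length_eq hg h₄
    simp only [length_cons] at hl₂ hl₃
    lia

/-- A normalized exchange: the common right factor may be assumed minimal. -/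
lemma TransUpTo.exists_pair {a b : S × Bool} {d d' u w w' : Word S}
    (hp : PairEq A a.1 b.1 (a :: d) (b :: d')) (hg : PairGeo A a.1 b.1 (a :: d))
    (hg' : PairGeo A a.1 b.1 (b :: d')) (h₁ : Eqv A w (d ++ u)) (h₂ : Eqv A w' (d' ++ u))
    (hl : w.length ≤ n) (hr : Red A (a :: w)) :
    Red A (b :: w') ∧ ∃ d d' u, PairEq A a.1 b.1 (a :: d) (b :: d') ∧
      PairGeo A a.1 b.1 (a :: d) ∧ PairGeo A a.1 b.1 (b :: d') ∧ MinPair A a.1 b.1 u ∧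
      Eqv A w (d ++ u) ∧ Eqv A w' (d' ++ u) := by
  have hr₁ : Red A (d ++ u) := H.red hl hr.1 h₁
  have hl₁ := h₁.length_eq
  have hl₂ := h₂.length_eq
  have hl₃ := hg.length_eq hg' hp
  simp only [length_append, length_cons] at hl₁ hl₂ hl₃
  obtain ⟨q, u₀, hq, hu₀, h₃, hr₂⟩ := H.decomp hg.nil (by lia) hr₁.of_append
  have h₄ := H.trans hl hr.1 h₁ (h₃.append_left d)
  have hr₃ := H.red_cons hl hr h₄
  rw [← append_assoc] at h₄ hr₃
  have hdq := hr₃.pairGeo (x := a :: (d ++ q)) hg.nil (hg.over.append hq.over)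
  have hpq := hp.append_right hq.over
  have hdq' := hdq.of_length_le (d' := b :: (d' ++ q)) hpq (by simp; lia)
  have hl₄ := h₃.length_eq
  simp only [length_append] at hl₄
  have hr₄ : Red A (b :: (d' ++ q) ++ u₀) :=
    H.red_append hdq' hu₀ hr₂.of_append (by simp; lia)
  have hr₅ : Red A (d' ++ (q ++ u₀)) := append_assoc d' q u₀ ▸ hr₄.1
  replace hr₅ : Red A (d' ++ u) := H.red (by simp; lia) hr₅ (h₃.symm.append_left d')
  have hr₆ : Red A w' := H.red (by simp; lia) hr₅ h₂.symm
  have h₅ : Eqv A w' (d' ++ q ++ u₀) := by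
    rw [append_assoc]
    exact H.trans (by lia) hr₆ h₂ (h₃.append_left d')
  exact ⟨H.red_cons (by simp; lia) hr₄ h₅.symm, d ++ q, d' ++ q, u₀, hpq, hdq, hdq', hu₀, h₄, h₅⟩

end level
end eqv

/-! ### Transitivity of the equivalence on reduced words -/

section trans
variable {A : ArtinData S} {s t : S}

/-- A geodesic `{s,t}`-word with representatives beginning with both generators is not of the
form `t^k s^i`. -/
lemma PairGeo.not_pow {p f d d' : Word S} {a b : S × Bool} (hp : ∀ l ∈ p, l.1 = t)
    (ha : a.1 = s) (hb : b.1 = t) (hg : PairGeo A s t (a :: d)) (hg' : PairGeo A s t (b :: d'))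
    (hpf : PairGeo A s t (p ++ f)) (h : PairEq A s t (p ++ f) (a :: d))
    (h' : PairEq A s t (p ++ f) (b :: d')) (q : Word S) (hq : ∀ l ∈ q, l.1 = s)
    (hqg : PairGeo A s t q) (hfq : PairEq A s t f q) : False := by
  have he := hfq.append_left (e := p) hpf.of_append_left.over
  have hl := hpf.of_append_right.length_eq hqg hfq
  have hpq := hpf.of_length_le he (by simp [hl])
  have hb' := he.symm.trans h'
  exact PairGeo.two_syllables_head hp hq ha hb hg hg' hpq (he.symm.trans h) hb'

/-- A configuration that is shown not to exist: a word with equivalents beginning with the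
distinct generators `x` and `y`, whose maximal left factor over `{y,z}` is not a power of
`y`. -/
structure Bad (A : ArtinData S) (h : Word S) (x y z : S) : Prop where
  red : Red A h
  ne : x ≠ y
  ne' : x ≠ z
  head_x : ∃ a w, a.1 = x ∧ Eqv A h (a :: w)
  head_y : ∃ a w, a.1 = y ∧ Eqv A h (a :: w)
  factor : ∃ f u, PairGeo A y z f ∧ MinPair A y z u ∧ Eqv A h (f ++ u) ∧
    ∀ q, (∀ l ∈ q, l.1 = y) → PairGeo A y z q → ¬ PairEq A y z f q

section level
variable {n : ℕ} (H : TransUpTo A n)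
include H

lemma TransUpTo.decomp_of_strip {h f u p h' : Word S} (hl : h.length ≤ n) (hr : Red A h)
    (hf : PairGeo A s t f) (hu : MinPair A s t u) (he : Eqv A h (f ++ u))
    (hp : ∀ l ∈ p, l.1 = t) (hh' : ∀ c v, c.1 = t → ¬ Eqv A h' (c :: v))
    (he' : Eqv A h (p ++ h')) :
    ∃ f₁ u₁, Eqv A h' (f₁ ++ u₁) ∧ PairGeo A s t f₁ ∧ MinPair A s t u₁ ∧
      PairGeo A s t (p ++ f₁) ∧ PairEq A s t f (p ++ f₁) ∧
      (f₁ = [] ∨ ∃ c g, f₁ = c :: g ∧ c.1 = s) := by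
  have hr' := H.red hl hr he'
  have hl' := he'.length_eq
  simp only [length_append] at hl'
  obtain ⟨f₁, u₁, hf₁, hu₁, h₁, hr₁⟩ := H.decomp hf.nil (by lia) hr'.of_append
  have h₂ := H.trans hl hr he' (h₁.append_left p)
  rw [← append_assoc] at h₂
  have hpf : PairGeo A s t (p ++ f₁) :=
    (H.red hl hr h₂).pairGeo hf.nil (Over.append (fun l hl => .inr (hp l hl)) hf₁.over)
  have hr₂ := H.red hl hr he
  have h₃ := H.trans (he.length_eq ▸ hl) hr₂ he.symm h₂
  refine ⟨f₁, u₁, h₁, hf₁, hu₁, hpf,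
    (H.decomp_unique (he.length_eq ▸ hl) hr₂ hf hpf hu hu₁ h₃).2, ?_⟩
  obtain _ | ⟨c, g⟩ := f₁
  · exact .inl rfl
  · refine .inr ⟨c, g, rfl, (hf₁.over c mem_cons_self).resolve_right fun hc => ?_⟩
    exact hh' c _ hc h₁

lemma TransUpTo.exists_head {h f u w : Word S} {a : S × Bool} (hl : h.length ≤ n)
    (hr : Red A h) (hf : PairGeo A s t f) (hu : MinPair A s t u) (he : Eqv A h (f ++ u))
    (ha : a.1 = s ∨ a.1 = t) (he' : Eqv A h (a :: w)) :
    ∃ g, PairEq A s t f (a :: g) ∧ PairGeo A s t (a :: g) := by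
  have hl' := he'.length_eq
  simp only [length_cons] at hl'
  obtain ⟨g, v, hg, hv, h₁, -⟩ := H.decomp hf.nil (by lia) (H.red hl hr he').1
  have h₂ := H.trans hl hr he' (h₁.cons a)
  have hag : PairGeo A s t (a :: g) :=
    (H.red hl hr h₂).pairGeo (x := a :: g) hf.nil (hg.over.cons ha)
  have hr₂ := H.red hl hr he
  have h₃ : Eqv A (f ++ u) ((a :: g) ++ v) := H.trans (he.length_eq ▸ hl) hr₂ he.symm h₂
  exact ⟨g, (H.decomp_unique (he.length_eq ▸ hl) hr₂ hf hag hu hv h₃).2, hag⟩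

lemma TransUpTo.not_bad {h : Word S} {x y z : S} (hl : h.length ≤ n) : ¬ Bad A h x y z := by
  obtain ⟨m, hm⟩ : ∃ m, h.length = m := ⟨_, rfl⟩
  induction m using Nat.strong_induction_on generalizing h x y z with
  | h m ih =>
    rintro ⟨hr, hxy, hxz, ⟨a, w, rfl, ha⟩, ⟨b, w', rfl, hb⟩, f, u, hf, hu, hfu, hpow⟩
    obtain ⟨p, h', hp, hh', hph, hr'⟩ := H.strip (· = b.1) hl hr
    have hl' := hph.length_eq
    have hp0 : p ≠ [] := by
      rintro rfl
      exact hh' b w' rfl (H.trans (hph.length_eq ▸ hl) hr' hph.symm hb)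
    rw [length_append] at hl'
    have hp1 := length_pos_iff.2 hp0
    have hn : PairGeo A a.1 b.1 [] := by
      have := H.trans (ha.length_eq ▸ hl) (H.red hl hr ha) ha.symm hb
      rcases eqv_cons_iff.1 this with ⟨rfl, -⟩ | ⟨_, _, _, -, hg, -⟩
      · exact absurd rfl hxy
      · exact hg.nil
    obtain ⟨f₀, u₀, h₀, -, -, hg₀, hp₀, hf₀⟩ :=
      H.decomp_of_strip hl hr hf.swap hu.swap hfu hp hh' hph
    obtain ⟨e, v, he, hv, hev, -⟩ := H.decomp hn hl hr
    obtain ⟨d, hd, hdg⟩ := H.exists_head hl hr he hv hev (.inl rfl) ha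
    obtain ⟨d', hd', hdg'⟩ := H.exists_head hl hr he hv hev (.inr rfl) hb
    obtain ⟨f₁, u₁, h₁, hg₁, hm₁, hpg₁, hp₁, hf₁⟩ :=
      H.decomp_of_strip hl hr he hv hev hp hh' hph
    have hnp := PairGeo.not_pow hp rfl rfl hdg hdg' hpg₁ (hp₁.symm.trans hd) (hp₁.symm.trans hd')
    refine ih h'.length (by lia) (h := h') (x := z) (y := a.1) (z := b.1) (by lia) rfl
      ⟨hr'.of_append, hxz.symm, hf.ne.symm, ?_, ?_, f₁, u₁, hg₁, hm₁, h₁, hnp⟩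
    · rcases hf₀ with rfl | ⟨c, g, rfl, hc⟩
      · rw [append_nil] at hg₀ hp₀
        exact (hpow p hp hg₀.swap hp₀.swap).elim
      · exact ⟨c, _, hc, h₀⟩
    · rcases hf₁ with rfl | ⟨c, g, rfl, hc⟩
      · exact (hnp [] (by simp) hg₁ hg₁.refl).elim
      · exact ⟨c, _, hc, h₁⟩

lemma TransUpTo.not_two_exchanges {a b c : S × Bool} {w d d' u e e' v : Word S}
    (hl : w.length ≤ n) (hr : Red A w) (hac : a.1 ≠ c.1)
    (hd : PairEq A a.1 b.1 (a :: d) (b :: d')) (hdg : PairGeo A a.1 b.1 (a :: d))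
    (hdg' : PairGeo A a.1 b.1 (b :: d')) (hu : MinPair A a.1 b.1 u) (hw : Eqv A w (d' ++ u))
    (he : PairEq A b.1 c.1 (b :: e) (c :: e')) (heg : PairGeo A b.1 c.1 (b :: e))
    (heg' : PairGeo A b.1 c.1 (c :: e')) (hv : MinPair A b.1 c.1 v) (hw' : Eqv A w (e ++ v)) :
    False := by
  obtain ⟨p, h, hp, hh, hph, hr'⟩ := H.strip (· = b.1) hl hr
  have hl' := hph.length_eq
  rw [length_append] at hl'
  have key {a d d' u} (hd : PairEq A a.1 b.1 (a :: d) (b :: d'))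
      (hdg : PairGeo A a.1 b.1 (a :: d)) (hdg' : PairGeo A a.1 b.1 (b :: d'))
      (hu : MinPair A a.1 b.1 u) (hw : Eqv A w (d' ++ u)) :
      (∃ c g, c.1 = a.1 ∧ Eqv A h (c :: g)) ∧ ∃ f u, PairGeo A a.1 b.1 f ∧
        MinPair A a.1 b.1 u ∧ Eqv A h (f ++ u) ∧
        ∀ q, (∀ l ∈ q, l.1 = a.1) → PairGeo A a.1 b.1 q → ¬ PairEq A a.1 b.1 f q := by
    obtain ⟨f₁, u₁, h₁, hg₁, hm₁, hpg₁, hp₁, hf₁⟩ :=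
      H.decomp_of_strip hl hr hdg'.of_cons hu hw hp hh hph
    have he := hp₁.cons (a := b) (.inr rfl)
    have hnp := PairGeo.not_pow (p := b :: p) (forall_mem_cons.2 ⟨rfl, hp⟩) rfl rfl hdg hdg'
      (hdg'.of_length_le he (by simp [hdg'.of_cons.length_eq hpg₁ hp₁])) (he.symm.trans hd.symm)
      he.symm
    refine ⟨?_, f₁, u₁, hg₁, hm₁, h₁, hnp⟩
    rcases hf₁ with rfl | ⟨c, g, rfl, hc⟩
    · exact (hnp [] (by simp) hg₁ hg₁.refl).elim
    · exact ⟨c, _, hc, h₁⟩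
  have k₁ := key hd hdg hdg' hu hw
  have k₂ := key he.symm.swap heg'.swap heg.swap hv.swap hw'
  exact H.not_bad (h := h) (by lia)
    ⟨hr'.of_append, hac.symm, he.ne.symm, k₂.1, k₁.1, k₁.2⟩

lemma TransUpTo.succ : TransUpTo A (n + 1) := by
  intro x y z hl hr hxy hyz
  have red_of {x y : Word S} (hl : x.length ≤ n + 1) (hr : Red A x) (h : Eqv A x y) :
      Red A y := by
    rcases h with _ | ⟨a, h⟩ | ⟨h, hg, hg', h₁, h₂⟩
    · exact hr
    · exact H.red_cons (by simpa using hl) hr h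
    · exact (H.exists_pair h hg hg' h₁ h₂ (by simpa using hl) hr).1
  have hry := red_of hl hr hxy
  have hly := hxy.length_eq
  have hrz := red_of (hly ▸ hl) hry hyz
  refine ⟨hry, ?_⟩
  have hlz := hyz.length_eq
  obtain _ | ⟨a, w⟩ := x
  · obtain rfl := length_eq_zero_iff.1 hly.symm
    exact hyz
  obtain _ | ⟨b, w'⟩ := y
  · simp at hly
  obtain _ | ⟨c, w''⟩ := z
  · simp at hlz
  simp only [length_cons, Nat.add_right_cancel_iff] at hl hly hlz
  rcases eqv_cons_iff.1 hxy with ⟨rfl, h⟩ | ⟨d, d', u, hd, hdg, hdg', h₁, h₂⟩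
  · rcases eqv_cons_iff.1 hyz with ⟨rfl, h'⟩ | ⟨e, e', v, he, heg, heg', h₃, h₄⟩
    · exact (H.trans (by lia) hr.1 h h').cons a
    · exact .pair he heg heg' (H.trans (by lia) hr.1 h h₃) h₄
  rcases eqv_cons_iff.1 hyz with ⟨rfl, h'⟩ | ⟨e, e', v, he, heg, heg', h₃, h₄⟩
  · exact .pair hd hdg hdg' h₁ (H.trans (by lia) hrz.1 h'.symm h₂)
  obtain ⟨-, d, d', u, hd, hdg, hdg', hu, h₁, h₂⟩ :=
    H.exists_pair hd hdg hdg' h₁ h₂ (by lia) hr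
  obtain ⟨-, e, e', v, he, heg, heg', hv, h₃, h₄⟩ :=
    H.exists_pair he heg heg' h₃ h₄ (by lia) hry
  by_cases hac : a.1 = c.1
  · rw [← hac] at he heg heg' hv
    have hrw := H.red (by lia) hry.1 h₂
    obtain ⟨huv, hde⟩ := H.decomp_unique (h₂.length_eq ▸ (by lia)) hrw hdg'.of_cons
      heg.of_cons.swap hu hv.swap (H.trans (h₂.length_eq ▸ (by lia)) hrw h₂.symm h₃)
    have hace := (hd.trans (hde.cons (.inr rfl))).trans he.swap
    rcases eq_or_eq_letterInv hac with rfl | rfl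
    · have h₅ := hace.of_cons.eqv hdg.of_cons heg'.swap.of_cons u
      have hr₁ := H.red (by lia) hr.1 h₁
      have hl₁ := h₁.length_eq
      have hl₂ := h₅.length_eq
      have h₆ := H.trans (by lia) (H.red (by lia) hr₁ h₅) (huv.append_left e') h₄.symm
      exact (H.trans (by lia) hr.1 h₁ (H.trans (by lia) hr₁ h₅ h₆)).cons c
    · exact (hace.fst_ne_letterInv hdg heg'.swap).elim
  · exact (H.not_two_exchanges (by lia) hry.1 hac hd hdg hdg' hu h₂ he heg heg' hv h₃).elim

omit H in
lemma transUpTo (n : ℕ) : TransUpTo A n := by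
  induction n with
  | zero =>
    intro x y z hl hr hxy hyz
    have hly := hxy.length_eq
    have hlz := hyz.length_eq
    obtain rfl : x = [] := length_eq_zero_iff.1 (by lia)
    obtain rfl : y = [] := length_eq_zero_iff.1 hly.symm
    exact ⟨hr, hyz⟩
  | succ n ih => exact ih.succ

end level

lemma Eqv.red {x y : Word S} (h : Eqv A x y) (hx : Red A x) : Red A y :=
  (transUpTo x.length).red le_rfl hx h

lemma Eqv.trans {x y z : Word S} (h : Eqv A x y) (hx : Red A x) (h' : Eqv A y z) : Eqv A x z :=
  (transUpTo x.length).trans le_rfl hx h h'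

lemma Eqv.red_cons {a : S × Bool} {x y : Word S} (h : Eqv A x y) (hx : Red A (a :: x)) :
    Red A (a :: y) :=
  (transUpTo x.length).red_cons le_rfl hx h

lemma Red.decomp (hn : PairGeo A s t []) {x : Word S} (hx : Red A x) : ∃ f u,
    PairGeo A s t f ∧ MinPair A s t u ∧ Eqv A x (f ++ u) ∧ Red A (f ++ u) :=
  (transUpTo x.length).decomp hn le_rfl hx

lemma MinPair.red_append {d u : Word S} (hu : MinPair A s t u) (hd : PairGeo A s t d)
    (hr : Red A u) : Red A (d ++ u) :=
  (transUpTo _).red_append hd hu hr (Nat.le_succ _)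

end trans

/-! ### The action of the group on classes of reduced words -/

section action
variable {A : ArtinData S} {s t : S}

/-- Left multiplication of a reduced word by a letter, up to equivalence. -/
noncomputable def letterAct (A : ArtinData S) (a : S × Bool) (w : Word S) : Word S :=
  if h : ∃ u, Eqv A w (letterInv a :: u) then h.choose else a :: w

lemma letterAct_of_red {a : S × Bool} {w : Word S} (h : Red A (a :: w)) :
    letterAct A a w = a :: w :=
  dif_neg (not_exists.2 h.2)

lemma letterAct_of_eqv {a : S × Bool} {w u : Word S} (hr : Red A w)
    (h : Eqv A w (letterInv a :: u)) : Eqv A (letterAct A a w) u := by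
  have h' : ∃ u, Eqv A w (letterInv a :: u) := ⟨u, h⟩
  rw [letterAct, dif_pos h']
  exact (h'.choose_spec.symm.trans (h'.choose_spec.red hr) h).of_cons

lemma red_letterAct (a : S × Bool) {w : Word S} (hr : Red A w) : Red A (letterAct A a w) := by
  by_cases h : ∃ u, Eqv A w (letterInv a :: u)
  · rw [letterAct, dif_pos h]
    exact (h.choose_spec.red hr).1
  · rw [letterAct, dif_neg h]
    exact ⟨hr, not_exists.1 h⟩

lemma letterAct_congr (a : S × Bool) {w w' : Word S} (hr : Red A w) (h : Eqv A w w') :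
    Eqv A (letterAct A a w) (letterAct A a w') := by
  by_cases hu : ∃ u, Eqv A w (letterInv a :: u)
  · obtain ⟨u, hu⟩ := hu
    have hr' := h.red hr
    exact (letterAct_of_eqv hr hu).trans (red_letterAct a hr)
      (letterAct_of_eqv hr' (h.symm.trans hr' hu)).symm
  · have hr' : Red A (a :: w) := ⟨hr, not_exists.1 hu⟩
    rw [letterAct_of_red hr', letterAct_of_red (h.red_cons hr')]
    exact h.cons a

lemma letterAct_letterInv (a : S × Bool) {w : Word S} (hr : Red A w) :
    Eqv A (letterAct A (letterInv a) (letterAct A a w)) w := by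
  by_cases hu : ∃ u, Eqv A w (letterInv a :: u)
  · obtain ⟨u, hu⟩ := hu
    have h := letterAct_congr (letterInv a) (red_letterAct a hr) (letterAct_of_eqv hr hu)
    rw [letterAct_of_red (hu.red hr)] at h
    exact h.trans (red_letterAct _ (red_letterAct a hr)) hu.symm
  · have hr' : Red A (a :: w) := ⟨hr, not_exists.1 hu⟩
    rw [letterAct_of_red hr']
    exact letterAct_of_eqv hr' (by rw [letterInv_letterInv]; exact .refl _)

lemma length_letterAct_le (a : S × Bool) (w : Word S) :
    (letterAct A a w).length ≤ w.length + 1 := by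
  by_cases h : ∃ u, Eqv A w (letterInv a :: u)
  · rw [letterAct, dif_pos h]
    have := h.choose_spec.length_eq
    rw [length_cons] at this
    lia
  · rw [letterAct, dif_neg h, length_cons]

/-- Left multiplication of a reduced word by a word, up to equivalence. -/
noncomputable def wordAct (A : ArtinData S) (x w : Word S) : Word S := x.foldr (letterAct A) w

@[simp] lemma wordAct_cons (a : S × Bool) (x w : Word S) :
    wordAct A (a :: x) w = letterAct A a (wordAct A x w) := rfl

lemma red_wordAct (x : Word S) {w : Word S} (hr : Red A w) : Red A (wordAct A x w) := by
  induction x with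
  | nil => exact hr
  | cons a x ih => exact red_letterAct a ih

lemma wordAct_congr (x : Word S) {w w' : Word S} (hr : Red A w) (h : Eqv A w w') :
    Eqv A (wordAct A x w) (wordAct A x w') := by
  induction x with
  | nil => exact h
  | cons a x ih => exact letterAct_congr a (red_wordAct x hr) ih

lemma length_wordAct_le (x : Word S) : (wordAct A x []).length ≤ x.length := by
  induction x with
  | nil => rfl
  | cons a x ih => exact (length_letterAct_le a _).trans (Nat.succ_le_succ ih)

lemma wordAct_nil_of_red {x : Word S} (h : Red A x) : wordAct A x [] = x := by
  induction x with
  | nil => rfl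
  | cons a x ih => rw [wordAct_cons, ih h.1, letterAct_of_red h]

lemma wordAct_pair {x f u : Word S} (hx : Over s t x) (hf : PairGeo A s t f)
    (hu : MinPair A s t u) (hr : Red A u) :
    ∃ g, PairGeo A s t g ∧ PairEq A s t g (x ++ f) ∧ Eqv A (wordAct A x (f ++ u)) (g ++ u) := by
  induction x with
  | nil => exact ⟨f, hf, hf.refl, .refl _⟩
  | cons a x ih =>
    have ha := hx a mem_cons_self
    obtain ⟨g, hg, he, h⟩ := ih fun l hl => hx l (mem_cons_of_mem _ hl)
    have hfu := hu.red_append hf hr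
    have hgu := hu.red_append hg hr
    have h' := letterAct_congr a (red_wordAct x hfu) h
    rcases hg.cons_or ha with hag | ⟨g', hg', hag'⟩
    · have hr' : Red A (a :: (g ++ u)) := hu.red_append hag hr
      rw [letterAct_of_red hr'] at h'
      exact ⟨a :: g, hag, he.cons ha, h'⟩
    · exact ⟨g', hag'.of_cons, hg'.cons_letterInv.symm.trans (he.cons ha),
        h'.trans (red_letterAct a (red_wordAct x hfu))
          (letterAct_of_eqv hgu (hg'.eqv hg hag' u))⟩

lemma wordAct_eqv_of_pairEq {x y w : Word S} (h : PairEq A s t x y) (hn : PairGeo A s t [])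
    (hr : Red A w) : Eqv A (wordAct A x w) (wordAct A y w) := by
  obtain ⟨f, u, hf, hu, hw, hfu⟩ := hr.decomp hn
  obtain ⟨g, hg, hxg, hx⟩ := wordAct_pair h.over hf hu hfu.of_append
  obtain ⟨g', hg', hyg, hy⟩ := wordAct_pair h.symm.over hf hu hfu.of_append
  have key := (hxg.trans ((h.append_right hf.over).trans hyg.symm)).eqv hg hg' u
  refine (wordAct_congr x hr hw).trans (red_wordAct x hr) (hx.trans (red_wordAct x hfu)
    (key.trans (hx.red (red_wordAct x hfu)) ?_))
  exact hy.symm.trans (hu.red_append hg' hfu.of_append)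
    (wordAct_congr y hr hw).symm

/-- Equivalence as a setoid on reduced words. -/
def redSetoid (A : ArtinData S) : Setoid {w : Word S // Red A w} where
  r x y := Eqv A x.1 y.1
  iseqv := ⟨fun x => .refl x.1, fun h => h.symm, fun {x _ _} h₁ h₂ => h₁.trans x.2 h₂⟩

/-- The action of a letter on classes of reduced words. -/
noncomputable def letterMap (A : ArtinData S) (a : S × Bool) :
    Quotient (redSetoid A) → Quotient (redSetoid A) :=
  Quotient.map (fun w => ⟨letterAct A a w.1, red_letterAct a w.2⟩)
    fun w _ h => letterAct_congr a w.2 h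

lemma letterMap_letterInv (a : S × Bool) (q : Quotient (redSetoid A)) :
    letterMap A (letterInv a) (letterMap A a q) = q := by
  induction q using Quotient.inductionOn with
  | h w => exact Quotient.sound (letterAct_letterInv a w.2)

/-- The action of a generator on classes of reduced words, as a permutation. -/
noncomputable def genPerm (A : ArtinData S) (s : S) : Equiv.Perm (Quotient (redSetoid A)) where
  toFun := letterMap A (s, true)
  invFun := letterMap A (s, false)
  left_inv := letterMap_letterInv (s, true)
  right_inv := letterMap_letterInv (s, false)

lemma evalWord_genPerm (x : Word S) (w : {w : Word S // Red A w}) :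
    evalWord (genPerm A) x (Quotient.mk (redSetoid A) w) =
      Quotient.mk (redSetoid A) ⟨wordAct A x w.1, red_wordAct x w.2⟩ := by
  induction x with
  | nil => rfl
  | cons a x ih =>
    rw [evalWord_cons, Equiv.Perm.mul_apply, ih]
    obtain ⟨s, _ | _⟩ := a <;> rfl

lemma Red.geodesic (hlarge : ∀ s t : S, s ≠ t → 3 ≤ A.m s t) {w : Word S} (hw : Red A w) :
    Geodesic A w := by
  obtain ⟨φ, hφ⟩ := exists_hom (A := A) (genPerm A) (by
    intro s t k hst hk
    ext q
    induction q using Quotient.inductionOn with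
    | h w =>
      rw [evalWord_genPerm, evalWord_genPerm]
      exact Quotient.sound (wordAct_eqv_of_pairEq (pairEq_altWord hlarge hst hk)
        (pairGeo_nil hlarge hst hk) w.2))
  intro x hx
  have h : evalWord (genPerm A) x (Quotient.mk (redSetoid A) ⟨[], trivial⟩) =
      evalWord (genPerm A) w (Quotient.mk (redSetoid A) ⟨[], trivial⟩) := by
    rw [← hφ, ← hφ, hx]
  rw [evalWord_genPerm, evalWord_genPerm] at h
  have h' : Eqv A (wordAct A x []) (wordAct A w []) := Quotient.exact h
  rw [wordAct_nil_of_red hw] at h'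
  exact h'.length_eq ▸ length_wordAct_le x

end action

/-! ### Words that cannot be shortened are reduced -/

section stuck
variable {A : ArtinData S} {s t : S}

lemma exists_endsOff (s t : S) (u : Word S) :
    ∃ v z, u = v ++ emb s t z ∧ EndsOff s t v := by
  induction u using List.reverseRecOn with
  | nil => exact ⟨[], [], rfl, fun c hc => by simp at hc⟩
  | append_singleton u a ih =>
    by_cases ha : a.1 = s ∨ a.1 = t
    · obtain ⟨v, z, rfl, hv⟩ := ih
      obtain ⟨b, rfl⟩ := exists_embLetter ha
      exact ⟨v, z ++ [b], by simp [emb_append], hv⟩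
    · refine ⟨u ++ [a], [], by simp, fun c hc => ?_⟩
      obtain rfl : a = c := by simpa using hc
      exact not_or.1 ha

lemma exists_startsOff (s t : S) (u : Word S) :
    ∃ z v, u = emb s t z ++ v ∧ StartsOff s t v := by
  induction u with
  | nil => exact ⟨[], [], rfl, fun c hc => by simp at hc⟩
  | cons a u ih =>
    by_cases ha : a.1 = s ∨ a.1 = t
    · obtain ⟨z, v, rfl, hv⟩ := ih
      obtain ⟨b, rfl⟩ := exists_embLetter ha
      exact ⟨b :: z, v, by simp, hv⟩
    · refine ⟨[], a :: u, by simp, fun c hc => ?_⟩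
      obtain rfl : a = c := by simpa using hc
      exact not_or.1 ha

lemma Stuck.steps_of_pairEq {p q d d' : Word S} (hw : Stuck A (p ++ d ++ q))
    (h : PairEq A s t d d') (hl : d.length = d'.length) :
    Steps012Star A (p ++ d ++ q) (p ++ d' ++ q) := by
  obtain ⟨hst, k, hk, x, y, hm, rfl, rfl, hxy⟩ := h
  obtain ⟨p, e, rfl, hp⟩ := exists_endsOff s t p
  obtain ⟨f, q, rfl, hq⟩ := exists_startsOff s t q
  have key (z : Word Bool) : p ++ emb s t e ++ emb s t z ++ (emb s t f ++ q) =
      p ++ emb s t (e ++ z ++ f) ++ q := by simp [emb_append]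
  rw [key] at hw ⊢
  rw [key]
  have hs : Stuck (dih k hk) (e ++ x ++ f) := fun z hz => by
    simpa using hw _ (steps_emb hst hm hp hq hz)
  refine steps_emb hst hm hp hq (steps_of_geodesic_dih hk (hs.geodesic_dih hk) ?_ ?_)
  · simp [wbar_append, hxy]
  · simpa using hl

lemma Stuck.steps_of_eqv {p x y : Word S} (hw : Stuck A (p ++ x)) (h : Eqv A x y) :
    Steps012Star A (p ++ x) (p ++ y) := by
  induction hn : x.length generalizing p x y with
  | zero =>
    cases h with
    | nil => exact .refl
    | _ => simp at hn
  | succ n ih =>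
    cases h with
    | nil => simp at hn
    | cons a h =>
      rw [append_cons] at hw
      simpa using ih hw h (by simpa using hn)
    | @pair a b d d' u w w' he hg hg' h₁ h₂ =>
      have hd := hg.length_eq hg' he
      have hl₁ := h₁.length_eq
      have hl₂ := h₂.length_eq
      simp only [length_cons, length_append] at hn hd hl₁ hl₂
      have s₁ : Steps012Star A (p ++ a :: w) (p ++ (a :: d) ++ u) := by
        rw [append_cons] at hw ⊢
        simpa using ih hw h₁ (by lia)
      have hw₁ := hw.of_steps s₁ (by simp; lia)
      have s₂ := hw₁.steps_of_pairEq he hd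
      have hw₂ := hw₁.of_steps s₂ (by simp; lia)
      have s₃ : Steps012Star A (p ++ (b :: d') ++ u) (p ++ b :: w') := by
        have e : p ++ (b :: d') ++ u = (p ++ [b]) ++ (d' ++ u) := by simp
        rw [e] at hw₂ ⊢
        simpa using ih hw₂ h₂.symm (by simp; lia)
      exact (s₁.trans s₂).trans s₃

lemma Stuck.red {p x : Word S} (hw : Stuck A (p ++ x)) : Red A x := by
  induction x generalizing p with
  | nil => trivial
  | cons a x ih =>
    rw [append_cons] at hw
    refine ⟨ih hw, fun u hu => ?_⟩
    have h := hw.of_steps (hw.steps_of_eqv hu) (by simp [hu.length_eq])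
    rw [← append_cons] at h
    exact h.not_cancel

end stuck

/-- Proposition 2.22: in an Artin–Tits group of large type, every word can
be transformed by `→_{0,1,2⋆}` into a geodesic word representing the same element. -/
theorem stmt10 {S : Type*} [Finite S] (A : ArtinData S)
    (hlarge : ∀ s t : S, s ≠ t → 3 ≤ A.m s t) (w : Word S) :
    ∃ w' : Word S, Geodesic A w' ∧ wbar A w' = wbar A w ∧ Steps012Star A w w' := by
  obtain ⟨w', hs, hw⟩ := exists_stuck A w
  exact ⟨w', (Stuck.red (p := []) hw).geodesic hlarge, (wbar_steps hs).symm, hs⟩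

end ArtinTits
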